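/- arXiv:1801.03337 — 3 statements merged into one kernel-verified Lean document; each statement's English description precedes it below -/
import Mathlib

section
/- For all sufficiently large n, if f is a uniformly random Boolean function on F_2^n and u ∈ F_2^n is a fixed nonzero element, then P(|Δ_f(u)| ≥ 2√(2^n log 2^n)) ≥ 1/(2·2^n·√(log 2^n)). -/
open Finset

def ac {n : ℕ} (f : (Fin n → ZMod 2) → ZMod 2) (u : Fin n → ZMod 2) : ℤ :=
  ∑ x : Fin n → ZMod 2, (-1 : ℤ) ^ ((f x + f (x + u)).val)

open scoped Classical in
noncomputable def pr (n : ℕ) (p : ((Fin n → ZMod 2) → ZMod 2) → Prop) : ℝ :=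
  (Finset.univ.filter fun f => p f).card / Fintype.card ((Fin n → ZMod 2) → ZMod 2)

lemma sqrt_le_centralBinom_div (m : ℕ) :
    √(2 / (Real.pi * (2 * m + 1))) ≤ ((2 * m).choose m : ℝ) / 4 ^ m := by
  have h := Real.Wallis.W_le m
  rw [Real.Wallis.W_eq_factorial_ratio] at h
  apply Real.sqrt_le_iff.2
  refine ⟨by positivity, ?_⟩
  have hc : ((2 * m).choose m : ℝ) = (2 * m).factorial / (m.factorial ^ 2) := by
    rw [Nat.cast_choose ℝ (by omega : m ≤ 2 * m), show 2 * m - m = m by omega, sq]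
  have hf : (0 : ℝ) < m.factorial := by positivity
  have hf2 : (0 : ℝ) < (2 * m).factorial := by positivity
  have hpi := Real.pi_pos
  rw [hc, div_pow, div_pow, ← pow_mul, ← pow_mul, div_div, div_le_div_iff₀ (by positivity) (by positivity)]
  rw [div_le_iff₀ (by positivity)] at h
  have e : (2 : ℝ) ^ (4 * m) = 4 ^ (m * 2) := by
    rw [show (4 : ℝ) = 2 ^ 2 by norm_num, ← pow_mul]; ring_nf
  rw [e] at h
  norm_num at h ⊢
  nlinarith

lemma choose_step (m j : ℕ) (hj : j ≤ m) :
    ((2 * m).choose (m + (j + 1)) : ℝ) = (2 * m).choose (m + j) * ((m - j) / (m + j + 1)) := by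
  have h := Nat.choose_succ_right_eq (2 * m) (m + j)
  rw [show 2 * m - (m + j) = m - j by omega] at h
  have h' : ((2 * m).choose (m + (j + 1)) : ℝ) * (m + j + 1) = (2 * m).choose (m + j) * (m - j) := by
    rw [← Nat.cast_sub hj]; exact_mod_cast h
  field_simp
  linarith

lemma choose_add_ge_exp {m J : ℕ} (hJ : J < m) {j : ℕ} (hj : j ≤ J) :
    ((2 * m).choose m : ℝ) * Real.exp (-(j : ℝ) ^ 2 / (m - J)) ≤ (2 * m).choose (m + j) := by
  induction j with
  | zero => simp
  | succ j ih =>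
    have hJ' : (J : ℝ) < m := by exact_mod_cast hJ
    have hj' : (j : ℝ) + 1 ≤ J := by exact_mod_cast hj
    have h1 : (0 : ℝ) < m - J := by linarith
    have h2 : (0 : ℝ) < m - j := by linarith
    have hj0 : (0 : ℝ) ≤ j := by positivity
    rw [choose_step m j (by omega)]
    have key : Real.exp (-((2 * j + 1 : ℝ) / (m - J))) ≤ (m - j) / (m + j + 1) := by
      rw [Real.exp_neg, inv_le_comm₀ (Real.exp_pos _) (by positivity), inv_div]
      calc (m + j + 1 : ℝ) / (m - j) = (2 * j + 1) / (m - j) + 1 := by field_simp; ring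
        _ ≤ (2 * j + 1) / (m - J) + 1 := by gcongr; linarith
        _ ≤ _ := Real.add_one_le_exp _
    calc _ = ((2 * m).choose m : ℝ) * Real.exp (-(j : ℝ) ^ 2 / (m - J)) *
          Real.exp (-((2 * j + 1 : ℝ) / (m - J))) := by
            rw [mul_assoc, ← Real.exp_add]; congr 2; push_cast; field_simp; ring
      _ ≤ _ := by gcongr; exact ih (by omega)

lemma choose_add_ge_pow {m J T : ℕ} (hT : T ≤ m) {i : ℕ} (hi : J + i ≤ T) :
    ((2 * m).choose (m + J) : ℝ) * (((m : ℝ) - T) / (m + T + 1)) ^ i ≤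
      (2 * m).choose (m + (J + i)) := by
  induction i with
  | zero => simp
  | succ i ih =>
    have hT' : (T : ℝ) ≤ m := by exact_mod_cast hT
    have hi' : (J : ℝ) + i + 1 ≤ T := by exact_mod_cast hi
    rw [← add_assoc J, choose_step m (J + i) (by omega), pow_succ, ← mul_assoc]
    have h1 : (0 : ℝ) ≤ m - T := by linarith
    have : ((m : ℝ) - T) / (m + T + 1) ≤ (m - (J + i : ℕ)) / (m + (J + i : ℕ) + 1) := by
      push_cast
      gcongr <;> linarith
    gcongr
    exact ih (by omega)

set_option maxHeartbeats 1000000 in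
lemma le_sum_choose_div {m J K : ℕ} {s q : ℝ} (hs : s ^ 2 = m) (hq : 400 ≤ q)
    (hsq : 1000 * q ^ 3 ≤ s) (hexp : Real.exp (q ^ 2) = 4 * s ^ 2) (hJ : s * q ≤ J)
    (hJ' : J ≤ s * q + 1) (hK : s ≤ K) (hK' : K ≤ s + 1) :
    1 / (2 * (4 * s ^ 2) * q) ≤
      2 * ∑ i ∈ range K, ((2 * m).choose (m + (J + i)) : ℝ) / 4 ^ m := by
  have hq0 : 0 < q := by linarith
  have hq2 : 400 * q ≤ q ^ 2 := by nlinarith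
  have hq3 : 400 * q ^ 2 ≤ q ^ 3 := by nlinarith
  have hs1 : 1000 ≤ s := by nlinarith
  have hs0 : 0 < s := by linarith
  have hsq0 : 400 * s ≤ s * q := by nlinarith
  have hq3s : q ^ 3 * s ≤ s ^ 2 / 1000 := by nlinarith
  have hq2s : q ^ 2 * s ≤ q ^ 3 * s / 400 := by nlinarith
  have hqs : q * s ≤ q ^ 2 * s / 400 := by nlinarith
  have hTm : (J : ℝ) + K + 1 ≤ s ^ 2 := by nlinarith
  have hTmN : J + K + 1 ≤ m := by rw [hs] at hTm; exact_mod_cast hTm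
  have hJm : J < m := by omega
  have hJmR : (J : ℝ) < s ^ 2 := by rw [hs]; exact_mod_cast hJm
  have hc : 0.55 / s ≤ ((2 * m).choose m : ℝ) / 4 ^ m := by
    refine le_trans (Real.le_sqrt_of_sq_le ?_) (sqrt_le_centralBinom_div m)
    rw [← hs, div_pow, div_le_div_iff₀ (by positivity) (by positivity)]
    have := Real.pi_lt_d2
    have := Real.pi_pos
    nlinarith
  have hE : 0.99 / (4 * s ^ 2) ≤ Real.exp (-(J : ℝ) ^ 2 / (m - J)) := by
    have h1 : -q ^ 2 + -0.01 ≤ -(J : ℝ) ^ 2 / (m - J) := by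
      rw [← hs, le_div_iff₀ (by linarith)]
      have hJsq : (J : ℝ) ^ 2 ≤ (s * q + 1) ^ 2 := by gcongr
      have : (q ^ 2 + 0.01) * (J : ℝ) ≤ (q ^ 2 + 0.01) * (s * q + 1) := by gcongr
      nlinarith
    calc 0.99 / (4 * s ^ 2) = Real.exp (-q ^ 2) * 0.99 := by
          rw [Real.exp_neg, hexp]; field_simp
      _ ≤ Real.exp (-q ^ 2) * Real.exp (-0.01) := by
          gcongr
          have := Real.add_one_le_exp (-0.01 : ℝ)
          linarith
      _ = Real.exp (-q ^ 2 + -0.01) := by rw [Real.exp_add]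
      _ ≤ _ := Real.exp_le_exp.2 h1
  set T := J + K with hT
  set ρ : ℝ := ((m : ℝ) - T) / (m + T + 1) with hρ
  have hTR : (T : ℝ) = J + K := by rw [hT]; push_cast; rfl
  have hρ0 : 0 ≤ ρ := by
    apply div_nonneg <;> nlinarith
  have h1ρ : 1 - ρ = (2 * T + 1) / (s ^ 2 + T + 1) := by
    rw [hρ, ← hs]
    have : s ^ 2 + (T : ℝ) + 1 ≠ 0 := by positivity
    field_simp
    ring
  have hρle : 1 - ρ ≤ 2.02 * q / s := by
    rw [h1ρ, div_le_div_iff₀ (by positivity) (by positivity)]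
    have hD : 2 * (T : ℝ) + 1 ≤ 2.02 * (s * q) := by nlinarith
    calc (2 * (T : ℝ) + 1) * s ≤ 2.02 * (s * q) * s := by gcongr
      _ = 2.02 * q * s ^ 2 := by ring
      _ ≤ _ := by gcongr; have : (0 : ℝ) ≤ T := by positivity
                  linarith
  have hρge : q / s ≤ 1 - ρ := by
    rw [h1ρ, div_le_div_iff₀ (by positivity) (by positivity)]
    have hD : 2 * (s * q) ≤ 2 * (T : ℝ) + 1 := by nlinarith
    calc q * (s ^ 2 + T + 1) ≤ q * (2 * s ^ 2) := by gcongr; linarith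
      _ = 2 * (s * q) * s := by ring
      _ ≤ _ := by gcongr
  have hρK : ρ ^ K ≤ 0.01 := by
    calc ρ ^ K ≤ Real.exp (-(q / s)) ^ K := by
          gcongr
          have := Real.add_one_le_exp (-(q / s))
          linarith
      _ = Real.exp (-(q / s * K)) := by rw [← Real.exp_nat_mul]; ring_nf
      _ ≤ Real.exp (-q) := by
          apply Real.exp_le_exp.2
          rw [neg_le_neg_iff, div_mul_eq_mul_div, le_div_iff₀ hs0]
          gcongr
      _ ≤ 0.01 := by
          rw [Real.exp_neg, inv_le_comm₀ (Real.exp_pos _) (by norm_num)]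
          have := Real.add_one_le_exp q
          norm_num
          linarith
  have hG : 0.99 * s / (2.02 * q) ≤ ∑ i ∈ range K, ρ ^ i := by
    have h := mul_neg_geom_sum ρ K
    have hG0 : 0 ≤ ∑ i ∈ range K, ρ ^ i := sum_nonneg fun i _ => pow_nonneg hρ0 i
    have h2 : 0.99 ≤ 2.02 * q / s * ∑ i ∈ range K, ρ ^ i :=
      calc (0.99 : ℝ) ≤ (1 - ρ) * ∑ i ∈ range K, ρ ^ i := by rw [h]; linarith
        _ ≤ _ := by gcongr
    rw [div_mul_eq_mul_div, le_div_iff₀ hs0] at h2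
    rw [div_le_iff₀ (by positivity)]
    linarith
  have hsum : ((2 * m).choose m : ℝ) / 4 ^ m * Real.exp (-(J : ℝ) ^ 2 / (m - J)) *
      ∑ i ∈ range K, ρ ^ i ≤ ∑ i ∈ range K, ((2 * m).choose (m + (J + i)) : ℝ) / 4 ^ m := by
    rw [mul_sum]
    refine sum_le_sum fun i hi => ?_
    have hi' := mem_range.1 hi
    rw [div_mul_eq_mul_div, div_mul_eq_mul_div]
    gcongr
    refine le_trans ?_ (choose_add_ge_pow (m := m) (J := J) (T := T) (by omega) (by omega))
    gcongr
    exact choose_add_ge_exp hJm le_rfl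
  calc 1 / (2 * (4 * s ^ 2) * q)
      ≤ 2 * (0.55 / s * (0.99 / (4 * s ^ 2)) * (0.99 * s / (2.02 * q))) := by
        have : 2 * (0.55 / s * (0.99 / (4 * s ^ 2)) * (0.99 * s / (2.02 * q))) =
          (2 * 0.55 * 0.99 * 0.99 * 2 / 2.02) * (1 / (2 * (4 * s ^ 2) * q)) := by
            field_simp
        rw [this]
        apply le_mul_of_one_le_left (by positivity)
        norm_num
    _ ≤ 2 * (((2 * m).choose m : ℝ) / 4 ^ m * Real.exp (-(J : ℝ) ^ 2 / (m - J)) *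
      ∑ i ∈ range K, ρ ^ i) := by gcongr
    _ ≤ _ := by gcongr

lemma add_add_self_zmod_two {n : ℕ} (x u : Fin n → ZMod 2) : x + u + u = x := by
  ext j
  simp [add_assoc, CharTwo.add_self_eq_zero]

lemma card_half {n : ℕ} {u : Fin n → ZMod 2} {i : Fin n} (hi : u i = 1) :
    2 * #{x : Fin n → ZMod 2 | x i = 0} = 2 ^ n := by
  have h : #{x : Fin n → ZMod 2 | ¬ x i = 0} = #{x : Fin n → ZMod 2 | x i = 0} := by
    refine card_bij' (fun x _ => x + u) (fun x _ => x + u) ?_ ?_ ?_ ?_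
    · simp only [mem_filter, mem_univ, true_and, Pi.add_apply, hi]
      intro x; generalize x i = a; revert a; decide
    · simp only [mem_filter, mem_univ, true_and, Pi.add_apply, hi]
      intro x; generalize x i = a; revert a; decide
    · exact fun x _ => add_add_self_zmod_two x u
    · exact fun x _ => add_add_self_zmod_two x u
  have h2 := card_filter_add_card_filter_not (s := (univ : Finset (Fin n → ZMod 2))) (fun x => x i = 0)
  rw [h] at h2
  simp at h2
  omega

lemma ac_eq_two_mul_sum {n : ℕ} {u : Fin n → ZMod 2} {i : Fin n} (hi : u i = 1)
    (f : (Fin n → ZMod 2) → ZMod 2) :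
    ac f u = 2 * ∑ x with x i = 0, (-1 : ℤ) ^ ((f x + f (x + u)).val) := by
  have h : ∑ x with ¬ x i = 0, (-1 : ℤ) ^ ((f x + f (x + u)).val) =
      ∑ x with x i = 0, (-1 : ℤ) ^ ((f x + f (x + u)).val) := by
    refine sum_bij' (fun x _ => x + u) (fun x _ => x + u) ?_ ?_ ?_ ?_ ?_
    · simp only [mem_filter, mem_univ, true_and, Pi.add_apply, hi]
      intro x; generalize x i = a; revert a; decide
    · simp only [mem_filter, mem_univ, true_and, Pi.add_apply, hi]
      intro x; generalize x i = a; revert a; decide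
    · exact fun x _ => add_add_self_zmod_two x u
    · exact fun x _ => add_add_self_zmod_two x u
    · intro x _; rw [add_add_self_zmod_two, add_comm]
  rw [ac, ← sum_filter_add_sum_filter_not univ (fun x => x i = 0), h, two_mul]

open scoped Classical in
/-- The function equal to the indicator of `A` on the hyperplane `x i = 0`, and whose derivative in
direction `u` is the indicator of `T` there. -/
noncomputable def ofSets {n : ℕ} (u : Fin n → ZMod 2) (i : Fin n)
    (p : Finset (Fin n → ZMod 2) × Finset (Fin n → ZMod 2)) (x : Fin n → ZMod 2) : ZMod 2 :=
  if x i = 0 then (if x ∈ p.1 then 1 else 0)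
  else (if x + u ∈ p.1 then 1 else 0) + (if x + u ∈ p.2 then 1 else 0)

open scoped Classical in
lemma ofSets_add_ofSets {n : ℕ} {u : Fin n → ZMod 2} {i : Fin n} (hi : u i = 1)
    (p : Finset (Fin n → ZMod 2) × Finset (Fin n → ZMod 2)) {x : Fin n → ZMod 2} (hx : x i = 0) :
    ofSets u i p x + ofSets u i p (x + u) = if x ∈ p.2 then 1 else 0 := by
  have hxu : x + u + u = x := add_add_self_zmod_two x u
  simp [ofSets, hx, hi, hxu, ← add_assoc, CharTwo.add_self_eq_zero]

lemma ac_ofSets {n : ℕ} {u : Fin n → ZMod 2} {i : Fin n} (hi : u i = 1)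
    (A : Finset (Fin n → ZMod 2)) {T : Finset (Fin n → ZMod 2)}
    (hT : T ⊆ univ.filter fun x => x i = 0) :
    ac (ofSets u i (A, T)) u = 2 ^ n - 4 * #T := by
  classical
  have h : ∑ x with x i = 0, (-1 : ℤ) ^ ((ofSets u i (A, T) x + ofSets u i (A, T) (x + u)).val) =
      ∑ x with x i = 0, (1 - 2 * if x ∈ T then 1 else 0) := by
    refine sum_congr rfl fun x hx => ?_
    rw [ofSets_add_ofSets hi _ (mem_filter.1 hx).2]
    by_cases h : x ∈ T <;> simp [h, ZMod.val_one]
  rw [ac_eq_two_mul_sum hi, h, sum_sub_distrib, ← mul_sum, sum_boole, filter_mem_eq_inter,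
    inter_eq_right.2 hT]
  have := card_half hi
  simp only [sum_const, nsmul_eq_mul, mul_one]
  have h3 : (2 : ℤ) * #{x : Fin n → ZMod 2 | x i = 0} = 2 ^ n := by exact_mod_cast this
  linarith

lemma ofSets_injOn {n : ℕ} {u : Fin n → ZMod 2} {i : Fin n} (hi : u i = 1) :
    Set.InjOn (ofSets u i) {p | p.1 ⊆ univ.filter (fun x => x i = 0) ∧
      p.2 ⊆ univ.filter fun x => x i = 0} := by
  classical
  rintro ⟨A, T⟩ ⟨hA, hT⟩ ⟨A', T'⟩ ⟨hA', hT'⟩ h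
  simp only at hA hT hA' hT'
  ext x
  · by_cases hx : x i = 0
    · have := congrFun h x
      simp only [ofSets, hx, if_true] at this
      by_cases h1 : x ∈ A <;> by_cases h2 : x ∈ A' <;> simp_all
    · exact iff_of_false (fun h => hx (mem_filter.1 (hA h)).2) fun h => hx (mem_filter.1 (hA' h)).2
  · by_cases hx : x i = 0
    · have h1 := ofSets_add_ofSets hi (A, T) hx
      rw [h, ofSets_add_ofSets hi (A', T') hx] at h1
      by_cases h1 : x ∈ T <;> by_cases h2 : x ∈ T' <;> simp_all
    · exact iff_of_false (fun h => hx (mem_filter.1 (hT h)).2) fun h => hx (mem_filter.1 (hT' h)).2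

lemma sum_choose_le_pr {n M : ℕ} (hM : 2 * M = 2 ^ n) {u : Fin n → ZMod 2} (hu : u ≠ 0)
    (p : ℤ → Prop) [DecidablePred p] :
    (∑ k ∈ range (M + 1), (M.choose k : ℝ) * if p (2 ^ n - 4 * k) then 1 else 0) / 2 ^ M ≤
      pr n fun f => p (ac f u) := by
  classical
  obtain ⟨i, hi⟩ := Function.ne_iff.1 hu
  replace hi : u i = 1 := by
    revert hi; rw [Pi.zero_apply]; generalize u i = a; revert a; decide
  set R : Finset (Fin n → ZMod 2) := univ.filter fun x => x i = 0 with hR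
  have hRM : #R = M := by have := card_half hi; rw [← hR] at this; omega
  have h1 : #(R.powerset ×ˢ {T ∈ R.powerset | p (2 ^ n - 4 * #T)}) ≤
      #{f : (Fin n → ZMod 2) → ZMod 2 | p (ac f u)} := by
    refine card_le_card_of_injOn (ofSets u i) ?_ ((ofSets_injOn hi).mono ?_)
    · rintro ⟨A, T⟩ h
      simp only [coe_product, Set.mem_prod, mem_coe, mem_powerset, mem_filter] at h
      simpa [ac_ofSets hi A h.2.1] using h.2.2
    · rintro ⟨A, T⟩ h
      simp only [coe_product, Set.mem_prod, mem_coe, mem_powerset, mem_filter] at h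
      exact ⟨h.1, h.2.1⟩
  have h2 : ((#{T ∈ R.powerset | p (2 ^ n - 4 * #T)} : ℕ) : ℝ) =
      ∑ k ∈ range (M + 1), (M.choose k : ℝ) * if p (2 ^ n - 4 * k) then 1 else 0 := by
    have := sum_powerset_apply_card (fun k : ℕ => if p (2 ^ n - 4 * k) then (1 : ℝ) else 0) (x := R)
    rw [hRM] at this
    simp only [nsmul_eq_mul] at this
    rw [← this, sum_boole]
  have h3 : (Fintype.card ((Fin n → ZMod 2) → ZMod 2) : ℝ) = 2 ^ M * 2 ^ M := by
    rw [← pow_add, ← two_mul, hM]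
    simp [ZMod.card]
  rw [pr, h3, ← h2, div_le_div_iff₀ (by positivity) (by positivity)]
  rw [card_product, card_powerset, hRM] at h1
  have h4 : (2 : ℝ) ^ M * #{T ∈ R.powerset | p (2 ^ n - 4 * #T)} ≤
    #{f : (Fin n → ZMod 2) → ZMod 2 | p (ac f u)} := by exact_mod_cast h1
  calc _ = (2 : ℝ) ^ M * #{T ∈ R.powerset | p (2 ^ n - 4 * #T)} * 2 ^ M := by ring
    _ ≤ _ := by gcongr; refine h4.trans_eq ?_; congr!

lemma two_mul_sum_choose_le {m J K : ℕ} (hJ : 0 < J) (hK : J + K ≤ m) {w : ℕ → ℝ}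
    (hw : ∀ k, 0 ≤ w k) (hw1 : ∀ i, w (m + (J + i)) = 1) (hw2 : ∀ i < K, w (m - (J + i)) = 1) :
    2 * ∑ i ∈ range K, ((2 * m).choose (m + (J + i)) : ℝ) ≤
      ∑ k ∈ range (2 * m + 1), ((2 * m).choose k : ℝ) * w k := by
  classical
  set g : ℕ → ℝ := fun k => ((2 * m).choose k : ℝ) * w k
  have e1 : ∑ i ∈ range K, ((2 * m).choose (m + (J + i)) : ℝ) =
      ∑ k ∈ (range K).image fun i => m + (J + i), g k := by
    rw [sum_image (by intro a _ b _ h; simp only at h; omega)]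
    simp [g, hw1]
  have e2 : ∑ i ∈ range K, ((2 * m).choose (m + (J + i)) : ℝ) =
      ∑ k ∈ (range K).image fun i => m - (J + i), g k := by
    rw [sum_image (by intro a ha b hb h; simp only [coe_range, Set.mem_Iio] at *; omega)]
    refine sum_congr rfl fun i hi => ?_
    have hi := mem_range.1 hi
    simp only [g, hw2 i hi, mul_one]
    rw [Nat.choose_symm_of_eq_add (show 2 * m = (m + (J + i)) + (m - (J + i)) by omega)]
  rw [two_mul]
  nth_rw 1 [e1]
  rw [e2, ← sum_union]
  · refine sum_le_sum_of_subset_of_nonneg ?_ fun k _ _ => mul_nonneg (by positivity) (hw k)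
    intro k hk
    simp only [mem_union, mem_image, mem_range] at *
    omega
  · rw [disjoint_left]
    intro k hk hk'
    simp only [mem_image, mem_range] at *
    omega

lemma eventually_growth :
    ∃ N : ℕ, ∀ n ≥ N, 400 ≤ √(Real.log (2 ^ n)) ∧
      1000 * √(Real.log (2 ^ n)) ^ 3 ≤ √(2 ^ (n - 2)) ∧ 2 ≤ n := by
  have h := tendsto_pow_const_div_const_pow_of_one_lt 3 (by norm_num : (1 : ℝ) < 2)
  obtain ⟨N, hN⟩ := Filter.eventually_atTop.1
    (h.eventually_le_const (by norm_num : (0 : ℝ) < 1 / (4 * 10 ^ 6)))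
  refine ⟨max N 320000, fun n hn => ?_⟩
  have hn1 := hN n (le_of_max_le_left hn)
  have hn2 : 320000 ≤ n := le_of_max_le_right hn
  have hn2' : (320000 : ℝ) ≤ n := by exact_mod_cast hn2
  have hl := Real.log_two_gt_d9
  have hl' := Real.log_two_lt_d9
  rw [Real.log_pow]
  refine ⟨Real.le_sqrt_of_sq_le (by nlinarith), Real.le_sqrt_of_sq_le ?_, by omega⟩
  have e : √((n : ℝ) * Real.log 2) ^ 2 = n * Real.log 2 := Real.sq_sqrt (by positivity)
  have e2 : (2 : ℝ) ^ n = 2 ^ (n - 2) * 4 := by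
    rw [show (4 : ℝ) = 2 ^ 2 by norm_num, ← pow_add]; congr 1; omega
  rw [div_le_div_iff₀ (by positivity) (by positivity)] at hn1
  calc (1000 * √((n : ℝ) * Real.log 2) ^ 3) ^ 2 = 10 ^ 6 * (√((n : ℝ) * Real.log 2) ^ 2) ^ 3 := by ring
    _ = 10 ^ 6 * (n * Real.log 2) ^ 3 := by rw [e]
    _ ≤ 10 ^ 6 * (n * 1) ^ 3 := by gcongr; linarith
    _ ≤ _ := by rw [mul_one]; linarith

theorem stmt4 :
    ∃ N : ℕ, ∀ n ≥ N, ∀ u : Fin n → ZMod 2, u ≠ 0 →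
      1 / (2 * 2 ^ n * Real.sqrt (Real.log (2 ^ n)))
        ≤ pr n fun f => 2 * Real.sqrt (2 ^ n * Real.log (2 ^ n)) ≤ |(ac f u : ℝ)| := by
  classical
  obtain ⟨N, hN⟩ := eventually_growth
  refine ⟨N, fun n hn u hu => ?_⟩
  obtain ⟨hq, hsq, hn2⟩ := hN n hn
  set q := √(Real.log (2 ^ n)) with hqdef
  set s : ℝ := √(2 ^ (n - 2)) with hsdef
  set m : ℕ := 2 ^ (n - 2) with hm
  have hmn : 2 ^ n = 4 * m := by
    rw [hm, show 4 = 2 ^ 2 by norm_num, ← pow_add]; congr 1; omega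
  have hmnR : (2 : ℝ) ^ n = 4 * m := by exact_mod_cast hmn
  have hs : s ^ 2 = m := by rw [hsdef, Real.sq_sqrt (by positivity), hm]; push_cast; rfl
  have hs0 : 0 ≤ s := Real.sqrt_nonneg _
  have hq2 : q ^ 2 = Real.log (2 ^ n) :=
    Real.sq_sqrt (Real.log_nonneg (one_le_pow₀ (by norm_num)))
  have hexp : Real.exp (q ^ 2) = 4 * s ^ 2 := by
    rw [hq2, Real.exp_log (by positivity), hs, hmnR]
  have hthr : √(2 ^ n * Real.log (2 ^ n)) = 2 * (s * q) := by
    rw [← hq2, hmnR, ← hs, show 4 * s ^ 2 * q ^ 2 = (2 * (s * q)) ^ 2 by ring]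
    exact Real.sqrt_sq (by positivity)
  have hq3 : q ≤ q ^ 3 := le_self_pow₀ (by linarith) (by norm_num)
  have hs1 : 1000 ≤ s := by linarith
  have hsq0 : 0 < s * q := by nlinarith
  set J := ⌈s * q⌉₊
  set K := ⌈s⌉₊
  have hJ : s * q ≤ J := Nat.le_ceil _
  have hJ' : (J : ℝ) ≤ s * q + 1 := (Nat.ceil_lt_add_one hsq0.le).le
  have hK : s ≤ K := Nat.le_ceil _
  have hK' : (K : ℝ) ≤ s + 1 := (Nat.ceil_lt_add_one hs0).le
  have hJK : J + K ≤ m := by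
    have : (J : ℝ) + K ≤ m := by rw [← hs]; nlinarith
    exact_mod_cast this
  have hmain := le_sum_choose_div hs hq hsq hexp hJ hJ' hK hK'
  have hpr := sum_choose_le_pr (M := 2 * m) (by omega) hu
    fun z : ℤ => 2 * √(2 ^ n * Real.log (2 ^ n)) ≤ |(z : ℝ)|
  have htail := two_mul_sum_choose_le (m := m) (K := K) (Nat.ceil_pos.2 hsq0) hJK
    (w := fun k => if 2 * √(2 ^ n * Real.log (2 ^ n)) ≤ |((2 ^ n - 4 * k : ℤ) : ℝ)| then 1 else 0)
    (fun k => by positivity)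
    (fun i => if_pos (by
      rw [hthr]
      push_cast
      rw [hmnR]
      refine le_trans ?_ (neg_le_abs _)
      have : (0 : ℝ) ≤ i := by positivity
      linarith))
    (fun i hi => if_pos (by
      rw [hthr, Int.cast_sub, Int.cast_mul, Int.cast_natCast, Nat.cast_sub (by omega)]
      push_cast
      rw [hmnR]
      refine le_trans ?_ (le_abs_self _)
      have : (0 : ℝ) ≤ i := by positivity
      linarith))
  refine le_trans ?_ hpr
  calc _ = 1 / (2 * (4 * s ^ 2) * q) := by rw [hs, ← hmnR]
    _ ≤ _ := hmain
    _ = (2 * ∑ i ∈ range K, ((2 * m).choose (m + (J + i)) : ℝ)) / 2 ^ (2 * m) := by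
        rw [← sum_div, pow_mul, mul_div_assoc]; norm_num
    _ ≤ _ := by gcongr
end

section
/- Let λ_l = 2√(l log l) with l = 2^n. For n ≥ 7 and distinct nonzero u, v ∈ F_2^n, if f is a uniformly random Boolean function on F_2^n then P(|Δ_f(u)| ≥ λ_l and |Δ_f(v)| ≥ λ_l) < 4 l^{-2}. -/
open Finset

/-- Sign patterns on one coset of `⟨u, v⟩`. -/
abbrev Block : Type := ZMod 2 × ZMod 2 → ZMod 2

/-- Contribution of one coset to the autocorrelation in direction `d`. -/
def blockCorr (d : ZMod 2 × ZMod 2) (b : Block) : ℤ :=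
  ∑ p : ZMod 2 × ZMod 2, (-1 : ℤ) ^ ((b p + b (p + d)).val)

/-- Unnormalized averaging over the step `12 · δ₀ + 2 · δ₁ + 2 · δ₋₁`. -/
def walkStep (h : ℤ → ℝ) : ℤ → ℝ := fun z => 12 * h z + 2 * h (z + 1) + 2 * h (z - 1)

/-- `ζ` takes the values `0, 1, -1` exactly `12, 2, 2` times. -/
def IsLazyStep (ζ : Block → ℤ) : Prop :=
  (∀ b, ζ b = 0 ∨ ζ b = 1 ∨ ζ b = -1) ∧ #{b | ζ b = 0} = 12 ∧ #{b | ζ b = 1} = 2 ∧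
    #{b | ζ b = -1} = 2

lemma IsLazyStep.neg {ζ : Block → ℤ} (hζ : IsLazyStep ζ) : IsLazyStep fun b => -ζ b := by
  obtain ⟨h, h0, h1, h2⟩ := hζ
  refine ⟨fun b => ?_, ?_, ?_, ?_⟩
  · rcases h b with h | h | h <;> simp [h]
  · simpa using h0
  · simpa [neg_eq_iff_eq_neg] using h2
  · simpa using h1

lemma IsLazyStep.sum_comp {ζ : Block → ℤ} (hζ : IsLazyStep ζ) (h : ℤ → ℝ) :
    ∑ b, h (ζ b) = 12 * h 0 + 2 * h 1 + 2 * h (-1) := by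
  obtain ⟨hv, h0, h1, h2⟩ := hζ
  have key : ∀ b, h (ζ b) = (if ζ b = 0 then h 0 else 0) + (if ζ b = 1 then h 1 else 0) +
      (if ζ b = -1 then h (-1) else 0) := by
    intro b
    rcases hv b with h | h | h <;> simp [h]
  simp_rw [key, sum_add_distrib, ← sum_filter, sum_const, h0, h1, h2]
  simp

lemma IsLazyStep.sum_walk {ζ : Block → ℤ} (hζ : IsLazyStep ζ) (m : ℕ) (h : ℤ → ℝ) (z : ℤ) :
    ∑ g : Fin m → Block, h (z + ∑ i, ζ (g i)) = walkStep^[m] h z := by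
  induction m generalizing z with
  | zero => simp
  | succ m ih =>
    rw [← (Fin.consEquiv fun _ => Block).sum_comp, Fintype.sum_prod_type]
    simp only [Fin.consEquiv_apply, Fin.sum_univ_succ, Fin.cons_zero, Fin.cons_succ]
    simp_rw [← add_assoc, ih, hζ.sum_comp fun y => walkStep^[m] h (z + y)]
    rw [Function.iterate_succ_apply', walkStep]
    simp [sub_eq_add_neg]

lemma walkStep_iterate_zpow {x : ℝ} (hx : x ≠ 0) (m : ℕ) :
    walkStep^[m] (fun z => x ^ z) = fun z => (12 + 2 * x + 2 / x) ^ m * x ^ z := by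
  induction m with
  | zero => simp
  | succ m ih =>
    rw [Function.iterate_succ_apply', ih]
    funext z
    rw [walkStep, zpow_add_one₀ hx, zpow_sub_one₀ hx]
    ring

/-- Reflection principle for the lazy walk. -/
lemma walkStep_iterate_nonneg (c : ℤ) (m : ℕ) {h : ℤ → ℝ} (ha : ∀ z, h (2 * c - 1 - z) = -h z)
    (hp : ∀ z < c, 0 ≤ h z) :
    (∀ z, walkStep^[m] h (2 * c - 1 - z) = -walkStep^[m] h z) ∧
      ∀ z < c, 0 ≤ walkStep^[m] h z := by
  induction m with
  | zero => exact ⟨ha, hp⟩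
  | succ m ih =>
    obtain ⟨ih1, ih2⟩ := ih
    rw [Function.iterate_succ_apply']
    set k := walkStep^[m] h
    constructor
    · intro z
      have h1 := ih1 (z - 1)
      have h2 := ih1 (z + 1)
      rw [show 2 * c - 1 - (z - 1) = 2 * c - 1 - z + 1 by ring] at h1
      rw [show 2 * c - 1 - (z + 1) = 2 * c - 1 - z - 1 by ring] at h2
      simp only [walkStep, ih1 z, h1, h2]
      ring
    · intro z hz
      have h0 := ih2 z hz
      have h1 := ih2 (z - 1) (by lia)
      simp only [walkStep]
      rcases eq_or_lt_of_le (show z + 1 ≤ c by lia) with hc | hc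
      · have h2 := ih1 z
        rw [show 2 * c - 1 - z = z + 1 by lia] at h2
        rw [h2]
        linarith
      · have h2 := ih2 (z + 1) hc
        positivity

lemma zpow_add_zpow_reflect {x : ℝ} (hx : 1 ≤ x) {c z : ℤ} (hz : c ≤ z) :
    x ^ c + x ^ (c - 1) ≤ x ^ z + x ^ (2 * c - 1 - z) := by
  obtain ⟨j, rfl⟩ : ∃ j : ℕ, z = c + j := ⟨(z - c).toNat, by lia⟩
  have hx0 : x ≠ 0 := by positivity
  have hj : 1 ≤ x ^ j := one_le_pow₀ hx
  have e1 : x ^ (c + j : ℤ) = x ^ c * x ^ j := by rw [zpow_add₀ hx0, zpow_natCast]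
  have e2 : x ^ (c - 1 : ℤ) = x ^ (2 * c - 1 - (c + j)) * x ^ j := by
    rw [← zpow_natCast, ← zpow_add₀ hx0]; congr 1; ring
  have e3 : x ^ (2 * c - 1 - (c + j)) ≤ x ^ c := zpow_le_zpow_right₀ hx (by lia)
  rw [e1, e2]
  nlinarith

lemma IsLazyStep.card_tail_le {ζ : Block → ℤ} (hζ : IsLazyStep ζ) (m : ℕ) {c : ℤ} (hc : 1 ≤ c)
    {x : ℝ} (hx : 1 ≤ x) :
    #{g : Fin m → Block | c ≤ ∑ i, ζ (g i)} * (x ^ c + x ^ (c - 1)) ≤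
      (12 + 2 * x + 2 / x) ^ m := by
  have hx0 : 0 < x := by positivity
  let h : ℤ → ℝ := fun z => if z < c then x ^ z else -x ^ (2 * c - 1 - z)
  have hh : 0 ≤ walkStep^[m] h 0 := by
    refine (walkStep_iterate_nonneg c m (fun z => ?_) fun z hz => ?_).2 0 (by lia)
    · by_cases hz : z < c
      · have : ¬ 2 * c - 1 - z < c := by lia
        simp [h, hz, this]
      · have : 2 * c - 1 - z < c := by lia
        simp [h, hz, this]
    · simp only [h, hz, if_true]
      positivity
  have e1 := hζ.sum_walk m h 0
  have e2 := hζ.sum_walk m (fun z => x ^ z) 0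
  rw [walkStep_iterate_zpow hx0.ne'] at e2
  simp only [zero_add, zpow_zero, mul_one] at e1 e2
  rw [← e1] at hh
  rw [← e2, ← nsmul_eq_mul, ← sum_const, sum_filter]
  calc _ ≤ ∑ g : Fin m → Block, (x ^ (∑ i, ζ (g i)) - h (∑ i, ζ (g i))) := by
        refine sum_le_sum fun g _ => ?_
        by_cases hz : c ≤ ∑ i, ζ (g i)
        · simpa [h, hz, not_lt.2 hz] using zpow_add_zpow_reflect hx hz
        · simp [h, hz, not_le.1 hz]
    _ ≤ _ := by rw [sum_sub_distrib]; linarith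

def blockAdd (b : Block) : ℤ := (blockCorr (1, 0) b + blockCorr (0, 1) b) / 8

def blockSub (b : Block) : ℤ := (blockCorr (1, 0) b - blockCorr (0, 1) b) / 8

lemma eight_mul_blockAdd : ∀ b : Block,
    8 * blockAdd b = blockCorr (1, 0) b + blockCorr (0, 1) b := by
  decide +kernel

lemma eight_mul_blockSub : ∀ b : Block,
    8 * blockSub b = blockCorr (1, 0) b - blockCorr (0, 1) b := by
  decide +kernel

lemma isLazyStep_blockAdd : IsLazyStep blockAdd := by
  unfold IsLazyStep
  decide +kernel

lemma isLazyStep_blockSub : IsLazyStep blockSub := by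
  unfold IsLazyStep
  decide +kernel

lemma exists_blockEquiv {n : ℕ} {u v : Fin n → ZMod 2} (hu : u ≠ 0) (hv : v ≠ 0) (huv : u ≠ v) :
    ∃ (m : ℕ) (e : Fin m × (ZMod 2 × ZMod 2) ≃ (Fin n → ZMod 2)), 4 * m = 2 ^ n ∧
      (∀ q p, e (q, p) + u = e (q, p + (1, 0))) ∧ ∀ q p, e (q, p) + v = e (q, p + (0, 1)) := by
  classical
  let Q := (Fin n → ZMod 2) ⧸ Submodule.span (ZMod 2) {u, v}
  have : Finite Q := Quotient.finite _
  obtain ⟨m, ⟨r⟩⟩ := Finite.exists_equiv_fin Q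
  let F : Fin m × (ZMod 2 × ZMod 2) → (Fin n → ZMod 2) := fun a =>
    (r.symm a.1).out + (a.2.1 • u + a.2.2 • v)
  have hout : ∀ q : Q, (Submodule.Quotient.mk q.out : Q) = q := fun q => Quotient.out_eq' q
  have hmk : ∀ a, (Submodule.Quotient.mk (F a) : Q) = r.symm a.1 := by
    intro a
    have h0 : (Submodule.Quotient.mk (a.2.1 • u + a.2.2 • v) : Q) = 0 :=
      (Submodule.Quotient.mk_eq_zero _).2 (Submodule.mem_span_pair.2 ⟨_, _, rfl⟩)
    rw [show F a = (r.symm a.1).out + (a.2.1 • u + a.2.2 • v) from rfl,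
      Submodule.Quotient.mk_add, h0, add_zero, hout]
  have hind : ∀ i j : ZMod 2, i • u + j • v = 0 → i = 0 ∧ j = 0 := by
    intro i j h
    have h2 : ∀ i : ZMod 2, i = 0 ∨ i = 1 := by decide
    rcases h2 i with rfl | rfl <;> rcases h2 j with rfl | rfl <;> simp_all
    exact huv (by rw [eq_neg_of_add_eq_zero_left h]; ext k; simp [ZMod.neg_eq_self_mod_two])
  have hinj : Function.Injective F := by
    rintro ⟨q, i, j⟩ ⟨q', i', j'⟩ h
    have hq : q = q' := by
      have := congrArg (Submodule.Quotient.mk : _ → Q) h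
      rw [hmk, hmk] at this
      exact r.symm.injective this
    subst hq
    have h' : i • u + j • v = i' • u + j' • v := add_left_cancel h
    have := hind (i - i') (j - j') (by rw [sub_smul, sub_smul, ← sub_eq_zero.2 h']; abel)
    simp [sub_eq_zero.1 this.1, sub_eq_zero.1 this.2]
  have hsurj : Function.Surjective F := by
    intro y
    have hy : y - (Submodule.Quotient.mk y : Q).out ∈ Submodule.span (ZMod 2) {u, v} := by
      rw [← Submodule.Quotient.mk_eq_zero, Submodule.Quotient.mk_sub, hout, sub_self]
    obtain ⟨i, j, hij⟩ := Submodule.mem_span_pair.1 hy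
    exact ⟨(r (Submodule.Quotient.mk y), i, j), by simp [F, hij]⟩
  let e := Equiv.ofBijective F ⟨hinj, hsurj⟩
  refine ⟨m, e, ?_, fun q p => ?_, fun q p => ?_⟩
  · have := Fintype.card_congr e
    simp [ZMod.card] at this
    lia
  · change F (q, p) + u = F (q, p + (1, 0))
    simp only [F, Prod.fst_add, Prod.snd_add, add_smul, one_smul, add_zero]
    abel
  · change F (q, p) + v = F (q, p + (0, 1))
    simp only [F, Prod.fst_add, Prod.snd_add, add_smul, one_smul, add_zero]
    abel

lemma three_add_cosh_le {t : ℝ} (h0 : 0 ≤ t) (h1 : t ≤ 1) :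
    (3 + Real.cosh t) / 4 ≤ Real.exp (t ^ 2 / 8 + t ^ 4 / 300) := by
  have hp := (abs_le.1 (Real.exp_bound (x := t) (n := 6) (by rwa [abs_of_nonneg h0])
    (by norm_num))).2
  have hm := (abs_le.1 (Real.exp_bound (x := -t) (n := 6) (by rwa [abs_neg, abs_of_nonneg h0])
    (by norm_num))).2
  rw [abs_neg] at hm
  rw [abs_of_nonneg h0] at hp hm
  simp only [sum_range_succ, sum_range_zero, Nat.factorial] at hp hm
  norm_num at hp hm
  have he := Real.quadratic_le_exp_of_nonneg (x := t ^ 2 / 8 + t ^ 4 / 300) (by positivity)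
  refine le_trans ?_ he
  rw [Real.cosh_eq]
  have h6 : t ^ 6 ≤ t ^ 4 := pow_le_pow_of_le_one h0 h1 (by norm_num)
  have h6' : 0 ≤ t ^ 6 := by positivity
  have h8 : 0 ≤ t ^ 8 := by positivity
  nlinarith

lemma tail_bound_large {n m : ℕ} (hn : 9 ≤ n) (hm : 4 * m = 2 ^ n) {c : ℤ}
    (hc : Real.sqrt (2 ^ n * Real.log (2 ^ n)) / 2 ≤ c) :
    ∃ x : ℝ, 1 ≤ x ∧
      ((6 + x + 1 / x) / 8) ^ m * (2 ^ n : ℝ) ^ 2 < x ^ c + x ^ (c - 1) := by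
  set l : ℝ := 2 ^ n with hl
  have hl0 : 0 < l := by positivity
  have hml : (m : ℝ) = l / 4 := by
    have : (4 * m : ℝ) = l := by rw [hl]; exact_mod_cast hm
    linarith
  have hlog : Real.log l = n * Real.log 2 := by rw [hl, Real.log_pow]
  have hlog0 : 0 < Real.log l := by
    rw [hlog]; have := Real.log_pos (x := 2) (by norm_num); positivity
  have hl2 := Real.log_two_lt_d9
  have hl2' := Real.log_two_gt_d9
  have hn1 : (512 * n : ℝ) ≤ 9 * l := by
    rw [hl]; norm_cast
    clear * - hn
    induction n, hn using Nat.le_induction with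
    | base => norm_num
    | succ k hk ih => rw [pow_succ]; lia
  have hn2 : (512 * n ^ 2 : ℝ) ≤ 81 * l := by
    rw [hl]; norm_cast
    clear * - hn
    induction n, hn using Nat.le_induction with
    | base => norm_num
    | succ k hk ih => rw [pow_succ 2]; nlinarith
  set s := Real.sqrt (l * Real.log l) with hs
  have hs2 : s ^ 2 = l * Real.log l := Real.sq_sqrt (by positivity)
  have hs0 : 0 < s := Real.sqrt_pos.2 (by positivity)
  set t : ℝ := 8 * s / l with ht
  have ht0 : 0 < t := by positivity
  have htsq : t ^ 2 * l = 64 * Real.log l := by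
    rw [ht, div_pow, mul_pow, hs2]; field_simp; ring
  have ht1 : t ≤ 1 := by
    have : t ^ 2 * l ≤ 1 * l := by rw [htsq, hlog]; nlinarith
    have := le_of_mul_le_mul_right this hl0
    nlinarith
  have ht4 : t ^ 4 * l ≤ 312 := by
    have : t ^ 4 * l * l ≤ 312 * l := by
      rw [show t ^ 4 * l * l = (t ^ 2 * l) ^ 2 by ring, htsq, hlog]
      have : Real.log 2 ^ 2 ≤ 0.481 := by nlinarith
      have : (n : ℝ) ^ 2 * Real.log 2 ^ 2 ≤ (81 * l / 512) * 0.481 := by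
        gcongr; linarith
      nlinarith
    exact le_of_mul_le_mul_right this hl0
  have hexp1 : (1 : ℝ) / 3 < Real.exp (-t) := by
    rw [Real.exp_neg, ← one_div]
    refine one_div_lt_one_div_of_lt (Real.exp_pos _) ?_
    have := Real.exp_le_exp.2 ht1
    have := Real.exp_one_lt_d9
    linarith
  have hexp2 : Real.exp 0.26 < 4 / 3 := by
    have := (abs_le.1 (Real.exp_bound (x := 0.26) (n := 4) (by norm_num [abs_of_nonneg])
      (by norm_num))).2
    simp only [sum_range_succ, sum_range_zero, Nat.factorial] at this
    norm_num [abs_of_nonneg] at this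
    norm_num
    linarith
  refine ⟨Real.exp t, Real.one_le_exp ht0.le, ?_⟩
  have hbase : (6 + Real.exp t + 1 / Real.exp t) / 8 = (3 + Real.cosh t) / 4 := by
    rw [Real.cosh_eq, Real.exp_neg]; ring
  have hl2exp : l ^ 2 = Real.exp (2 * Real.log l) := by
    rw [mul_comm, Real.exp_mul, Real.exp_log hl0]; norm_num
  have htc : 4 * Real.log l ≤ t * c := by
    have : t * (s / 2) = 4 * Real.log l := by
      rw [ht, show 8 * s / l * (s / 2) = 4 * s ^ 2 / l by ring, hs2]; field_simp
    rw [← this]; gcongr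
  rw [hbase, zpow_sub_one₀ (Real.exp_pos t).ne', ← Real.exp_neg]
  have hz : Real.exp t ^ c = Real.exp (t * c) := by rw [Real.exp_mul, Real.rpow_intCast]
  rw [hz]
  calc ((3 + Real.cosh t) / 4) ^ m * l ^ 2
      ≤ Real.exp (t ^ 2 / 8 + t ^ 4 / 300) ^ m * l ^ 2 := by
        gcongr
        exact three_add_cosh_le ht0.le ht1
    _ = Real.exp (t ^ 4 * l / 1200) * Real.exp (4 * Real.log l) := by
        rw [← Real.exp_nat_mul, hl2exp, ← Real.exp_add, ← Real.exp_add, hml]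
        congr 1
        linear_combination htsq / 32
    _ ≤ Real.exp 0.26 * Real.exp (t * c) := by gcongr; linarith
    _ < 4 / 3 * Real.exp (t * c) := by gcongr
    _ ≤ Real.exp (t * c) + Real.exp (t * c) * Real.exp (-t) := by
        nlinarith [Real.exp_pos (t * c)]

lemma exists_tail_bound {n m : ℕ} (hn : 7 ≤ n) (hm : 4 * m = 2 ^ n) :
    ∃ (c : ℤ) (x : ℝ), 1 ≤ c ∧ 1 ≤ x ∧
      (c : ℝ) - 1 < Real.sqrt (2 ^ n * Real.log (2 ^ n)) / 2 ∧
      ((6 + x + 1 / x) / 8) ^ m * (2 ^ n : ℝ) ^ 2 < x ^ c + x ^ (c - 1) := by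
  have hl2' := Real.log_two_gt_d9
  rcases lt_or_ge n 9 with h | h
  · interval_cases n
    · obtain rfl : m = 32 := by lia
      refine ⟨13, 4, by norm_num, by norm_num, ?_, by norm_num⟩
      rw [lt_div_iff₀ (by norm_num)]
      refine Real.lt_sqrt_of_sq_lt ?_
      rw [Real.log_pow]
      norm_num
      linarith
    · obtain rfl : m = 64 := by lia
      refine ⟨19, 3, by norm_num, by norm_num, ?_, by norm_num⟩
      rw [lt_div_iff₀ (by norm_num)]
      refine Real.lt_sqrt_of_sq_lt ?_
      rw [Real.log_pow]
      norm_num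
      linarith
  · obtain ⟨x, hx, hb⟩ := tail_bound_large h hm (Int.le_ceil _)
    refine ⟨_, x, ?_, hx, ?_, hb⟩
    · rw [Int.one_le_ceil_iff]
      have : 0 < Real.log (2 ^ n : ℝ) :=
        Real.log_pos (one_lt_pow₀ (by norm_num) (by lia))
      positivity
    · linarith [Int.ceil_lt_add_one (Real.sqrt (2 ^ n * Real.log (2 ^ n)) / 2)]

/-- Splitting a function along a decomposition of its domain into blocks. -/
def blockFunEquiv {n m : ℕ} (e : Fin m × (ZMod 2 × ZMod 2) ≃ (Fin n → ZMod 2)) :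
    ((Fin n → ZMod 2) → ZMod 2) ≃ (Fin m → Block) :=
  (Equiv.arrowCongr e.symm (Equiv.refl _)).trans (Equiv.curry _ _ _)

lemma ac_eq_sum_blockCorr {n m : ℕ} (e : Fin m × (ZMod 2 × ZMod 2) ≃ (Fin n → ZMod 2))
    {w : Fin n → ZMod 2} {d : ZMod 2 × ZMod 2} (he : ∀ q p, e (q, p) + w = e (q, p + d))
    (f : (Fin n → ZMod 2) → ZMod 2) :
    ac f w = ∑ q, blockCorr d (blockFunEquiv e f q) := by
  rw [ac, ← e.sum_comp, Fintype.sum_prod_type]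
  simp only [he]
  rfl

lemma le_abs_add_or_le_abs_sub {a b s : ℝ} (ha : s ≤ |a|) (hb : s ≤ |b|) :
    2 * s ≤ |a + b| ∨ 2 * s ≤ |a - b| := by
  rcases le_abs'.1 ha with h | h <;> rcases le_abs'.1 hb with h' | h'
  · left; rw [le_abs]; right; linarith
  · right; rw [le_abs]; right; linarith
  · right; rw [le_abs]; left; linarith
  · left; rw [le_abs]; left; linarith

lemma int_le_or_le_neg_of_le_abs {k c : ℤ} {s : ℝ} (hc : (c : ℝ) - 1 < s / 2)
    (h : 2 * (2 * s) ≤ |8 * (k : ℝ)|) : c ≤ k ∨ c ≤ -k := by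
  rw [← le_abs, ← Int.sub_one_lt_iff]
  have : ((c - 1 : ℤ) : ℝ) < ((|k| : ℤ) : ℝ) := by
    rw [abs_mul, abs_of_pos (by norm_num : (0 : ℝ) < 8)] at h
    push_cast
    linarith
  exact_mod_cast this

lemma card_large_le {n m : ℕ} {u v : Fin n → ZMod 2}
    (e : Fin m × (ZMod 2 × ZMod 2) ≃ (Fin n → ZMod 2))
    (hu : ∀ q p, e (q, p) + u = e (q, p + (1, 0))) (hv : ∀ q p, e (q, p) + v = e (q, p + (0, 1)))
    {c : ℤ} {s x : ℝ} (hc1 : 1 ≤ c) (hx : 1 ≤ x) (hc : (c : ℝ) - 1 < s / 2)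
    {A : Finset ((Fin n → ZMod 2) → ZMod 2)}
    (hA : ∀ f ∈ A, 2 * s ≤ |(ac f u : ℝ)| ∧ 2 * s ≤ |(ac f v : ℝ)|) :
    (#A : ℝ) * (x ^ c + x ^ (c - 1)) ≤ 4 * (12 + 2 * x + 2 / x) ^ m := by
  let T : (Block → ℤ) → Finset (Fin m → Block) := fun ζ => {g | c ≤ ∑ i, ζ (g i)}
  have hsub : A.map (blockFunEquiv e).toEmbedding ⊆
      (T blockAdd ∪ T fun b => -blockAdd b) ∪ (T blockSub ∪ T fun b => -blockSub b) := by
    intro g hg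
    obtain ⟨f, hf, rfl⟩ := mem_map.1 hg
    obtain ⟨h1, h2⟩ := hA f hf
    have hadd : (ac f u + ac f v : ℝ) = 8 * (∑ q, blockAdd (blockFunEquiv e f q) : ℤ) := by
      rw [ac_eq_sum_blockCorr e hu, ac_eq_sum_blockCorr e hv]
      norm_cast
      simp_rw [mul_sum, eight_mul_blockAdd, sum_add_distrib]
    have hsub : (ac f u - ac f v : ℝ) = 8 * (∑ q, blockSub (blockFunEquiv e f q) : ℤ) := by
      rw [ac_eq_sum_blockCorr e hu, ac_eq_sum_blockCorr e hv]
      norm_cast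
      simp_rw [mul_sum, eight_mul_blockSub, sum_sub_distrib]
    simp only [T, mem_union, mem_filter, mem_univ, true_and, sum_neg_distrib,
      Equiv.coe_toEmbedding]
    rcases le_abs_add_or_le_abs_sub h1 h2 with h | h
    · rw [hadd] at h
      exact Or.inl (int_le_or_le_neg_of_le_abs hc h)
    · rw [hsub] at h
      exact Or.inr (int_le_or_le_neg_of_le_abs hc h)
  have hcard : (#A : ℝ) ≤ (#(T blockAdd) + #(T fun b => -blockAdd b)) +
      (#(T blockSub) + #(T fun b => -blockSub b)) := by
    have h := card_le_card hsub
    rw [card_map] at h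
    exact_mod_cast h.trans ((card_union_le _ _).trans
      (add_le_add (card_union_le _ _) (card_union_le _ _)))
  have hx0 : 0 < x := by positivity
  have t1 := isLazyStep_blockAdd.card_tail_le m hc1 hx
  have t2 := isLazyStep_blockAdd.neg.card_tail_le m hc1 hx
  have t3 := isLazyStep_blockSub.card_tail_le m hc1 hx
  have t4 := isLazyStep_blockSub.neg.card_tail_le m hc1 hx
  have := mul_le_mul_of_nonneg_right hcard (show 0 ≤ x ^ c + x ^ (c - 1) by positivity)
  simp only [T] at this
  linarith

theorem stmt11 (n : ℕ) (hn : 7 ≤ n) (u v : Fin n → ZMod 2)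
    (hu : u ≠ 0) (hv : v ≠ 0) (huv : u ≠ v) :
    (pr n fun f =>
        2 * Real.sqrt (2 ^ n * Real.log (2 ^ n)) ≤ |(ac f u : ℝ)| ∧
        2 * Real.sqrt (2 ^ n * Real.log (2 ^ n)) ≤ |(ac f v : ℝ)|)
      < 4 / (2 ^ n : ℝ) ^ 2 := by
  classical
  obtain ⟨m, e, hm, heu, hev⟩ := exists_blockEquiv hu hv huv
  obtain ⟨c, x, hc1, hx, hc, hb⟩ := exists_tail_bound hn hm
  have hx0 : 0 < x := by positivity
  have hcard : Fintype.card ((Fin n → ZMod 2) → ZMod 2) = 16 ^ m := by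
    rw [Fintype.card_congr (blockFunEquiv e)]
    simp [ZMod.card]
  have key : ∀ A : Finset ((Fin n → ZMod 2) → ZMod 2),
      (∀ f ∈ A, 2 * Real.sqrt (2 ^ n * Real.log (2 ^ n)) ≤ |(ac f u : ℝ)| ∧
        2 * Real.sqrt (2 ^ n * Real.log (2 ^ n)) ≤ |(ac f v : ℝ)|) →
      (#A : ℝ) * (2 ^ n : ℝ) ^ 2 < 4 * 16 ^ m := by
    intro A hA
    have hX : 0 < x ^ c + x ^ (c - 1) := by positivity
    have hle := card_large_le e heu hev hc1 hx hc hA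
    have hbase : (12 + 2 * x + 2 / x) ^ m = 16 ^ m * ((6 + x + 1 / x) / 8) ^ m := by
      rw [← mul_pow]; congr 1; ring
    rw [hbase] at hle
    refine lt_of_mul_lt_mul_right ?_ hX.le
    calc _ = #A * (x ^ c + x ^ (c - 1)) * (2 ^ n : ℝ) ^ 2 := mul_right_comm _ _ _
      _ ≤ _ := mul_le_mul_of_nonneg_right hle (by positivity)
      _ = 4 * 16 ^ m * (((6 + x + 1 / x) / 8) ^ m * (2 ^ n : ℝ) ^ 2) := by ring
      _ < _ := by gcongr
  rw [pr, hcard, div_lt_div_iff₀ (by positivity) (by positivity)]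
  push_cast
  refine key _ fun f hf => ?_
  simpa only [mem_filter, mem_univ, true_and] using hf
end

section
/- If f is a uniformly random Boolean function on F_2^n, then Δ(f)/√(2^n log 2^n) → 2 in probability: for every ε > 0, P(|Δ(f)/(2√(2^n log 2^n)) - 1| > ε) → 0 as n → ∞. -/
open Finset Filter

def absInd {n : ℕ} (f : (Fin n → ZMod 2) → ZMod 2) : ℕ :=
  Finset.sup (Finset.univ.erase 0) fun u => (ac f u).natAbs

/-- One step of the lazy random walk on `ℤ`. -/
noncomputable def lazyStep (φ : ℤ → ℝ) (s : ℤ) : ℝ :=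
  φ s / 2 + (φ (s + 1) + φ (s - 1)) / 4

/-- One step of the planar walk that stays put with probability `1/2` and otherwise moves by a
uniform vector of `{±1} × {±1}`. -/
noncomputable def diagStep (Φ : ℤ → ℤ → ℝ) (s t : ℤ) : ℝ :=
  Φ s t / 2 +
    (Φ (s + 1) (t + 1) + Φ (s + 1) (t - 1) + Φ (s - 1) (t + 1) + Φ (s - 1) (t - 1)) / 8

lemma lazyStep_mono {φ ψ : ℤ → ℝ} (h : ∀ s, φ s ≤ ψ s) (s : ℤ) :
    lazyStep φ s ≤ lazyStep ψ s := by
  unfold lazyStep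
  linarith [h s, h (s + 1), h (s - 1)]

lemma lazyStep_iterate_mono (k : ℕ) {φ ψ : ℤ → ℝ} (h : ∀ s, φ s ≤ ψ s) (s : ℤ) :
    lazyStep^[k] φ s ≤ lazyStep^[k] ψ s := by
  induction k generalizing φ ψ with
  | zero => exact h s
  | succ k ih => exact ih (lazyStep_mono h)

lemma diagStep_iterate_mono (k : ℕ) {Φ Ψ : ℤ → ℤ → ℝ} (h : ∀ s t, Φ s t ≤ Ψ s t) (s t : ℤ) :
    diagStep^[k] Φ s t ≤ diagStep^[k] Ψ s t := by
  induction k generalizing Φ Ψ with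
  | zero => exact h s t
  | succ k ih =>
    refine ih fun a b => ?_
    unfold diagStep
    linarith [h a b, h (a + 1) (b + 1), h (a + 1) (b - 1), h (a - 1) (b + 1), h (a - 1) (b - 1)]

lemma diagStep_iterate_const_mul (k : ℕ) (c : ℝ) (Φ : ℤ → ℤ → ℝ) :
    diagStep^[k] (fun s t => c * Φ s t) = fun s t => c * diagStep^[k] Φ s t := by
  induction k generalizing Φ with
  | zero => rfl
  | succ k ih =>
    rw [Function.iterate_succ_apply, Function.iterate_succ_apply, ← ih]
    congr 1
    funext s t
    simp only [diagStep]
    ring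

lemma diagStep_iterate_fst (k : ℕ) (φ : ℤ → ℝ) :
    diagStep^[k] (fun s _ => φ s) = fun s _ => lazyStep^[k] φ s := by
  induction k generalizing φ with
  | zero => rfl
  | succ k ih =>
    rw [Function.iterate_succ_apply, Function.iterate_succ_apply, ← ih]
    congr 1
    funext s t
    simp only [diagStep, lazyStep]
    ring

lemma lazyStep_const_mul (c : ℝ) (φ : ℤ → ℝ) :
    lazyStep (fun s => c * φ s) = fun s => c * lazyStep φ s := by
  funext s
  simp only [lazyStep]
  ring

lemma lazyStep_iterate_const_mul (k : ℕ) (c : ℝ) (φ : ℤ → ℝ) :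
    lazyStep^[k] (fun s => c * φ s) = fun s => c * lazyStep^[k] φ s := by
  induction k generalizing φ with
  | zero => rfl
  | succ k ih =>
    rw [Function.iterate_succ_apply, Function.iterate_succ_apply, ← ih, lazyStep_const_mul]

/-- If `φ` is almost harmonic for the lazy walk, then the two coordinates of the diagonal walk are
almost independent when tested against `φ`. -/
lemma diagStep_iterate_mul_le (k : ℕ) {η : ℝ} (hη : η ≤ 1 / 2) {φ : ℤ → ℝ}
    (h0 : ∀ s, 0 ≤ φ s) (h : ∀ s, |lazyStep φ s - φ s| ≤ η * φ s) (s t : ℤ) :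
    diagStep^[k] (fun s t => φ s * φ t) s t ≤
      (1 + 4 * η ^ 2) ^ k * (lazyStep^[k] φ s * lazyStep^[k] φ t) := by
  induction k generalizing φ with
  | zero => simp
  | succ k ih =>
    have hP0 : ∀ s, 0 ≤ lazyStep φ s := fun s => by
      unfold lazyStep
      linarith [h0 s, h0 (s + 1), h0 (s - 1)]
    have hstep : ∀ s, |lazyStep (lazyStep φ) s - lazyStep φ s| ≤ η * lazyStep φ s := fun s => by
      have h1 := abs_le.1 (h s)
      have h2 := abs_le.1 (h (s + 1))
      have h3 := abs_le.1 (h (s - 1))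
      rw [abs_le]
      constructor
      · have : -(η * lazyStep φ s) =
            -(η * φ s) / 2 + (-(η * φ (s + 1)) + -(η * φ (s - 1))) / 4 := by
          simp only [lazyStep]; ring
        rw [this]
        conv_rhs => rw [lazyStep]; arg 2; rw [lazyStep]
        linarith
      · have : η * lazyStep φ s = (η * φ s) / 2 + (η * φ (s + 1) + η * φ (s - 1)) / 4 := by
          simp only [lazyStep]; ring
        rw [this]
        conv_lhs => rw [lazyStep]; arg 2; rw [lazyStep]
        linarith
    have hle : ∀ s, |lazyStep φ s - φ s| ≤ 2 * η * lazyStep φ s := fun s => by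
      have h1 := abs_le.1 (h s)
      have hη0 : 0 ≤ η * φ s := (abs_nonneg _).trans (h s)
      have h4 : φ s ≤ 2 * lazyStep φ s := by nlinarith [h0 s]
      rcases (h0 s).eq_or_lt with hz | hz
      · have := h s
        rw [← hz] at this ⊢
        simp only [mul_zero, sub_zero, abs_nonpos_iff] at this
        rw [this]; simp
      · have hη1 : 0 ≤ η := nonneg_of_mul_nonneg_left hη0 hz
        nlinarith [h s]
    have hdiag : ∀ a b, diagStep (fun s t => φ s * φ t) a b ≤
        (1 + 4 * η ^ 2) * (lazyStep φ a * lazyStep φ b) := fun a b => by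
      have e : diagStep (fun s t => φ s * φ t) a b =
          lazyStep φ a * lazyStep φ b + (lazyStep φ a - φ a) * (lazyStep φ b - φ b) := by
        simp only [diagStep, lazyStep]; ring
      have : (lazyStep φ a - φ a) * (lazyStep φ b - φ b) ≤
          (2 * η * lazyStep φ a) * (2 * η * lazyStep φ b) := by
        refine (le_abs_self _).trans ?_
        rw [abs_mul]
        exact mul_le_mul (hle a) (hle b) (abs_nonneg _) ((abs_nonneg _).trans (hle a))
      rw [e]
      linarith
    rw [Function.iterate_succ_apply, Function.iterate_succ_apply]
    refine (diagStep_iterate_mono k hdiag s t).trans ?_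
    rw [diagStep_iterate_const_mul, pow_succ' (1 + 4 * η ^ 2), mul_assoc]
    exact mul_le_mul_of_nonneg_left (ih hP0 hstep) (by positivity)

lemma lazyStep_iterate_quadratic_mul_exp (k : ℕ) (θ a b d c : ℝ) :
    lazyStep^[k] (fun s : ℤ => Real.exp (θ * s) * (a + b * (s - c) + d * (s - c) ^ 2)) =
      fun s : ℤ => ((1 + Real.cosh θ) / 2) ^ k * (Real.exp (θ * s) *
        (a + b * (s - c + k * Real.tanh (θ / 2)) + d * ((s - c + k * Real.tanh (θ / 2)) ^ 2
          + k * ((1 - Real.tanh (θ / 2) ^ 2) / 2)))) := by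
  induction k with
  | zero => simp
  | succ k ih =>
    rw [Function.iterate_succ_apply', ih, lazyStep_const_mul]
    funext s
    rw [pow_succ ((1 + Real.cosh θ) / 2), mul_assoc]
    congr 1
    simp only [lazyStep]
    push_cast
    have hθ : θ = 2 * (θ / 2) := by ring
    set x := θ / 2
    rw [hθ, Real.cosh_two_mul, Real.tanh_eq_sinh_div_cosh]
    have h1 : Real.exp (2 * x * (s + 1)) =
        Real.exp (2 * x * s) * (Real.cosh x + Real.sinh x) ^ 2 := by
      rw [Real.cosh_add_sinh, ← Real.exp_nat_mul, ← Real.exp_add]; congr 1; push_cast; ring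
    have h2 : Real.exp (2 * x * (s - 1)) =
        Real.exp (2 * x * s) * (Real.cosh x - Real.sinh x) ^ 2 := by
      rw [Real.cosh_sub_sinh, ← Real.exp_nat_mul, ← Real.exp_add]; congr 1; push_cast; ring
    rw [h1, h2]
    have hc := Real.cosh_pos x
    have hcs := Real.cosh_sq x
    set C := Real.cosh x
    set S := Real.sinh x
    set E := Real.exp (2 * x * s)
    have hS : S ^ 2 = C ^ 2 - 1 := by linarith
    have hz : (1 + (C ^ 2 + S ^ 2)) / 2 = C ^ 2 := by rw [hS]; ring
    rw [hz]
    set y : ℝ := s - c with hy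
    have e1 : (s : ℝ) + 1 - c = y + 1 := by rw [hy]; ring
    have e2 : (s : ℝ) - 1 - c = y - 1 := by rw [hy]; ring
    rw [e1, e2]
    have hT : S = C * (S / C) := by field_simp
    have hT2 : C ^ 2 * (1 - (S / C) ^ 2) = 1 := by
      field_simp
      linarith
    set T := S / C
    rw [hT]
    linear_combination (-(E / 2 * (a + b * (y + k * T) +
      d * ((y + k * T) ^ 2 + k * ((1 - T ^ 2) / 2))))) * hT2

lemma lazyStep_iterate_exp (k : ℕ) (θ : ℝ) :
    lazyStep^[k] (fun s => Real.exp (θ * s)) =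
      fun s : ℤ => ((1 + Real.cosh θ) / 2) ^ k * Real.exp (θ * s) := by
  simpa using lazyStep_iterate_quadratic_mul_exp k θ 1 0 0 0

lemma sq_cosh_half (θ : ℝ) : (1 + Real.cosh θ) / 2 = Real.cosh (θ / 2) ^ 2 := by
  have := Real.cosh_two_mul (θ / 2)
  rw [show 2 * (θ / 2) = θ by ring] at this
  linarith [Real.cosh_sq (θ / 2)]

lemma half_one_add_cosh_le_exp (θ : ℝ) : (1 + Real.cosh θ) / 2 ≤ Real.exp (θ ^ 2 / 4) := by
  rw [sq_cosh_half]
  refine (pow_le_pow_left₀ (Real.cosh_pos _).le (Real.cosh_le_exp_half_sq _) 2).trans_eq ?_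
  rw [← Real.exp_nat_mul]
  congr 1
  push_cast
  ring

lemma one_add_sq_div_two_le_cosh (x : ℝ) : 1 + x ^ 2 / 2 ≤ Real.cosh x := by
  rw [← sq_abs, ← Real.cosh_abs]
  have h := Real.cosh_two_mul (|x| / 2)
  rw [show 2 * (|x| / 2) = |x| by ring] at h
  have h1 : |x| / 2 ≤ Real.sinh (|x| / 2) := Real.self_le_sinh_iff.2 (by positivity)
  have h2 := Real.cosh_sq (|x| / 2)
  have h3 : 0 ≤ |x| / 2 := by positivity
  nlinarith

lemma exp_le_half_one_add_cosh (θ : ℝ) :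
    Real.exp (θ ^ 2 / 4 - θ ^ 4 / 16) ≤ (1 + Real.cosh θ) / 2 := by
  have h1 : 1 + θ ^ 2 / 4 ≤ (1 + Real.cosh θ) / 2 := by
    linarith [one_add_sq_div_two_le_cosh θ]
  refine le_trans ?_ h1
  rw [← Real.le_log_iff_exp_le (by positivity)]
  refine le_trans ?_ (Real.one_sub_inv_le_log_of_pos (by positivity))
  rw [← sub_nonneg]
  have : 1 - (1 + θ ^ 2 / 4)⁻¹ - (θ ^ 2 / 4 - θ ^ 4 / 16) =
      (θ ^ 2 / 4) ^ 3 / (1 + θ ^ 2 / 4) := by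
    field_simp
    ring
  rw [this]
  positivity

lemma sinh_le_mul_cosh {x : ℝ} (hx : 0 ≤ x) : Real.sinh x ≤ x * Real.cosh x := by
  have hd : ∀ y, HasDerivAt (fun y => y * Real.cosh y - Real.sinh y) (y * Real.sinh y) y :=
    fun y => by
      have := ((hasDerivAt_id y).mul (Real.hasDerivAt_cosh y)).sub (Real.hasDerivAt_sinh y)
      refine this.congr_deriv ?_
      simp
  have hmono : MonotoneOn (fun y => y * Real.cosh y - Real.sinh y) (Set.Ici 0) := by
    refine monotoneOn_of_deriv_nonneg (convex_Ici 0)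
      (fun y _ => (hd y).continuousAt.continuousWithinAt)
      (fun y _ => (hd y).differentiableAt.differentiableWithinAt) fun y hy => ?_
    rw [interior_Ici, Set.mem_Ioi] at hy
    rw [(hd y).deriv]
    exact mul_nonneg hy.le (Real.sinh_nonneg_iff.2 hy.le)
  have := hmono (Set.mem_Ici.2 le_rfl) (Set.mem_Ici.2 hx) hx
  simpa using this

lemma tanh_le_self {x : ℝ} (hx : 0 ≤ x) : Real.tanh x ≤ x := by
  rw [Real.tanh_eq_sinh_div_cosh, div_le_iff₀ (Real.cosh_pos x)]
  exact sinh_le_mul_cosh hx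

lemma sub_sq_le_tanh {x : ℝ} (hx : 0 ≤ x) : x - x ^ 2 ≤ Real.tanh x := by
  rw [Real.tanh_eq_sinh_div_cosh, le_div_iff₀ (Real.cosh_pos x)]
  have h1 : x ≤ Real.sinh x := Real.self_le_sinh_iff.2 hx
  have h2 : Real.cosh x ≤ Real.exp x := by linarith [Real.cosh_add_sinh x]
  have h3 : 1 - x ≤ Real.exp (-x) := by linarith [Real.add_one_le_exp (-x)]
  have h4 : Real.cosh x * (1 - x) ≤ 1 := calc
    Real.cosh x * (1 - x) ≤ Real.cosh x * Real.exp (-x) := by gcongr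
    _ ≤ Real.exp x * Real.exp (-x) := by gcongr
    _ = 1 := by rw [← Real.exp_add, add_neg_cancel, Real.exp_zero]
  calc (x - x ^ 2) * Real.cosh x = x * (Real.cosh x * (1 - x)) := by ring
    _ ≤ x * 1 := by gcongr
    _ ≤ Real.sinh x := by rwa [mul_one]

/-- The hyperbolic secant bump is almost harmonic for the lazy walk. -/
lemma abs_lazyStep_sech_sub_le (l c : ℝ) (s : ℤ) :
    |lazyStep (fun s => 1 / Real.cosh (l * (s - c))) s - 1 / Real.cosh (l * (s - c))| ≤
      Real.sinh l ^ 2 / 2 * (1 / Real.cosh (l * (s - c))) := by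
  simp only [lazyStep]
  push_cast
  have e1 : l * ((s : ℝ) + 1 - c) = l * (s - c) + l := by ring
  have e2 : l * ((s : ℝ) - 1 - c) = l * (s - c) - l := by ring
  rw [e1, e2, Real.cosh_add, Real.cosh_sub]
  set y := l * ((s : ℝ) - c)
  have hC := Real.one_le_cosh y
  have hc := Real.one_le_cosh l
  have hS := Real.cosh_sq y
  have hs := Real.cosh_sq l
  have p1 := Real.cosh_add y l ▸ Real.cosh_pos (y + l)
  have p2 := Real.cosh_sub y l ▸ Real.cosh_pos (y - l)
  set C := Real.cosh y
  set S := Real.sinh y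
  set a := Real.cosh l
  set b := Real.sinh l
  have hprod : (C * a + S * b) * (C * a - S * b) = C ^ 2 + b ^ 2 := by
    have : (C * a + S * b) * (C * a - S * b) = C ^ 2 * a ^ 2 - S ^ 2 * b ^ 2 := by ring
    rw [this, hs, show S ^ 2 = C ^ 2 - 1 by linarith]
    ring
  have key : 1 / C / 2 + (1 / (C * a + S * b) + 1 / (C * a - S * b)) / 4 - 1 / C =
      (C ^ 2 * a - (C ^ 2 + b ^ 2)) / (2 * (C ^ 2 + b ^ 2)) * (1 / C) := by
    have h3 : 1 / (C * a + S * b) + 1 / (C * a - S * b) = 2 * C * a / (C ^ 2 + b ^ 2) := by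
      rw [← hprod]
      field_simp
      ring
    rw [h3]
    field_simp
    ring
  rw [key, abs_mul, abs_of_pos (by positivity : 0 < 1 / C)]
  refine mul_le_mul_of_nonneg_right ?_ (by positivity)
  have hb : b ^ 2 = a ^ 2 - 1 := by linarith
  rw [abs_div, abs_of_pos (by positivity : 0 < 2 * (C ^ 2 + b ^ 2)), div_le_div_iff₀ (by positivity) (by positivity)]
  have h4 : |C ^ 2 * a - (C ^ 2 + b ^ 2)| ≤ b ^ 2 * (C ^ 2 + b ^ 2) := by
    have hC2 : 1 ≤ C ^ 2 := one_le_pow₀ hC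
    have ha : a - 1 ≤ b ^ 2 := by rw [hb]; nlinarith
    have hb0 : 0 ≤ b ^ 2 := sq_nonneg b
    rw [abs_le]
    constructor <;> nlinarith [mul_nonneg hb0 hb0, mul_nonneg hb0 (by linarith : 0 ≤ C ^ 2 - 1)]
  linarith

/-- Lower bound on the lazy-walk average of a hyperbolic secant bump centred at the mean of the
exponentially tilted walk. -/
lemma le_lazyStep_iterate_sech (k : ℕ) (hk : 0 < k) {θ l : ℝ} (hθ : 0 ≤ θ) (hl : 0 ≤ l) :
    Real.exp (-(k * θ ^ 2 / 4) - k * θ ^ 4 / 16 - l * √k) ≤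
      lazyStep^[k] (fun s => 1 / Real.cosh (l * (s - k * Real.tanh (θ / 2)))) 0 := by
  set m := Real.tanh (θ / 2) with hm
  set c : ℝ := k * m with hc
  set r : ℝ := √k with hr
  have hk' : (0 : ℝ) < k := Nat.cast_pos.2 hk
  have hr0 : 0 < r := Real.sqrt_pos.2 hk'
  have hrr : r * r = k := Real.mul_self_sqrt hk'.le
  have hpt : ∀ s : ℤ, Real.exp (-(θ * c) - l * r) * (Real.exp (θ * s) *
      ((1 + l * r - l * r / 2) + (-θ) * (s - c) + (-(l / (2 * r))) * (s - c) ^ 2)) ≤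
      1 / Real.cosh (l * (s - c)) := fun s => by
    have h1 : Real.exp (-(l * |s - c|)) ≤ 1 / Real.cosh (l * (s - c)) := by
      rw [Real.exp_neg, ← one_div]
      refine one_div_le_one_div_of_le (Real.cosh_pos _) ?_
      rw [← Real.cosh_abs, abs_mul, abs_of_nonneg hl]
      have := Real.cosh_add_sinh (l * |s - c|)
      have h2 : 0 ≤ Real.sinh (l * |s - c|) := Real.sinh_nonneg_iff.2 (by positivity)
      linarith
    refine le_trans ?_ h1
    have h2 : |s - c| ≤ (s - c) ^ 2 / (2 * r) + r / 2 := by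
      rw [← sq_abs]
      have : |s - c| ^ 2 / (2 * r) + r / 2 - |s - c| = (|s - c| - r) ^ 2 / (2 * r) := by
        field_simp
        ring
      have h3 : 0 ≤ (|s - c| - r) ^ 2 / (2 * r) := by positivity
      linarith
    have h3 : Real.exp (-(l * |s - c|)) = Real.exp (-(θ * c) - l * r) * (Real.exp (θ * s) *
        Real.exp (l * r - θ * (s - c) - l * |s - c|)) := by
      rw [← Real.exp_add, ← Real.exp_add]
      congr 1
      ring
    rw [h3]
    gcongr
    refine le_trans ?_ (Real.add_one_le_exp _)
    have h4 := mul_le_mul_of_nonneg_left h2 hl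
    have h5 : l * ((s - c) ^ 2 / (2 * r) + r / 2) = l / (2 * r) * (s - c) ^ 2 + l * r / 2 := by
      field_simp
    linarith
  refine le_trans ?_ (lazyStep_iterate_mono k hpt 0)
  rw [lazyStep_iterate_const_mul, lazyStep_iterate_quadratic_mul_exp, ← hm, ← hc]
  simp only [Int.cast_zero, mul_zero, Real.exp_zero, one_mul, zero_sub, neg_add_cancel]
  have hq : 1 ≤ 1 + l * r - l * r / 2 + -(l / (2 * r)) * (0 ^ 2 + k * ((1 - m ^ 2) / 2)) := by
    have : l / (2 * r) * (0 ^ 2 + k * ((1 - m ^ 2) / 2)) = l * r / 4 * (1 - m ^ 2) := by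
      rw [← hrr]
      field_simp
      ring
    have h2 : l * r / 4 * (1 - m ^ 2) ≤ l * r / 4 := by
      have : 0 ≤ l * r / 4 * m ^ 2 := by positivity
      linarith
    have h3 : 0 ≤ l * r := by positivity
    linarith
  calc Real.exp (-(k * θ ^ 2 / 4) - k * θ ^ 4 / 16 - l * r)
      ≤ Real.exp (-(θ * c) - l * r) * Real.exp (θ ^ 2 / 4 - θ ^ 4 / 16) ^ k := by
        rw [← Real.exp_nat_mul, ← Real.exp_add]
        refine Real.exp_le_exp.2 ?_
        have h1 : m ≤ θ / 2 := tanh_le_self (by positivity)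
        have h2 : θ * c ≤ θ * (k * (θ / 2)) := by
          rw [hc]
          gcongr
        linarith
    _ ≤ Real.exp (-(θ * c) - l * r) * ((1 + Real.cosh θ) / 2) ^ k := by
        gcongr
        exact exp_le_half_one_add_cosh θ
    _ ≤ _ := by
        refine mul_le_mul_of_nonneg_left ?_ (Real.exp_pos _).le
        refine le_mul_of_one_le_right (pow_nonneg ?_ _) ?_
        · linarith [Real.one_le_cosh θ]
        · simpa using hq

/-- The average of `F` over all Boolean functions on `F_2^n`. -/
noncomputable def avg (n : ℕ) (F : ((Fin n → ZMod 2) → ZMod 2) → ℝ) : ℝ :=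
  (∑ f, F f) / Fintype.card ((Fin n → ZMod 2) → ZMod 2)

lemma sum_pi_eq_diagStep_iterate {α : Type*} [Fintype α] (p q : α → ℤ)
    (h : ∀ (Φ : ℤ → ℤ → ℝ) (s t : ℤ),
      ∑ a, Φ (s + p a) (t + q a) = Fintype.card α * diagStep Φ s t)
    (k : ℕ) (Φ : ℤ → ℤ → ℝ) (s t : ℤ) :
    ∑ g : Fin k → α, Φ (s + ∑ i, p (g i)) (t + ∑ i, q (g i)) =
      (Fintype.card α : ℝ) ^ k * diagStep^[k] Φ s t := by
  induction k generalizing s t with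
  | zero => simp
  | succ k ih =>
    rw [← (Fin.consEquiv fun _ : Fin (k + 1) => α).sum_comp, Fintype.sum_prod_type]
    simp only [Fin.consEquiv_apply, Fin.sum_univ_succ, Fin.cons_zero, Fin.cons_succ, ← add_assoc]
    simp only [ih]
    rw [← Finset.mul_sum, h (diagStep^[k] Φ), Function.iterate_succ_apply', pow_succ, mul_assoc]

/-- The autocorrelation contribution of one coset of a plane in the first direction, divided by
`4`. -/
def planeCorrFst (g : ZMod 2 × ZMod 2 → ZMod 2) : ℤ :=
  (∑ b, (-1 : ℤ) ^ ((g b + g (b + (1, 0))).val)) / 4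

/-- The autocorrelation contribution of one coset of a plane in the second direction, divided by
`4`. -/
def planeCorrSnd (g : ZMod 2 × ZMod 2 → ZMod 2) : ℤ :=
  (∑ b, (-1 : ℤ) ^ ((g b + g (b + (0, 1))).val)) / 4

lemma four_mul_planeCorrFst (g : ZMod 2 × ZMod 2 → ZMod 2) :
    4 * planeCorrFst g = ∑ b, (-1 : ℤ) ^ ((g b + g (b + (1, 0))).val) := by
  revert g
  decide +kernel

lemma four_mul_planeCorrSnd (g : ZMod 2 × ZMod 2 → ZMod 2) :
    4 * planeCorrSnd g = ∑ b, (-1 : ℤ) ^ ((g b + g (b + (0, 1))).val) := by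
  revert g
  decide +kernel

lemma planeCorr_mem (g : ZMod 2 × ZMod 2 → ZMod 2) :
    (planeCorrFst g, planeCorrSnd g) ∈
      ({(0, 0), (1, 1), (1, -1), (-1, 1), (-1, -1)} : Finset (ℤ × ℤ)) := by
  revert g
  decide +kernel

lemma card_planeCorr :
    (univ.filter fun g => (planeCorrFst g, planeCorrSnd g) = (0, 0)).card = 8 ∧
    (univ.filter fun g => (planeCorrFst g, planeCorrSnd g) = (1, 1)).card = 2 ∧
    (univ.filter fun g => (planeCorrFst g, planeCorrSnd g) = (1, -1)).card = 2 ∧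
    (univ.filter fun g => (planeCorrFst g, planeCorrSnd g) = (-1, 1)).card = 2 ∧
    (univ.filter fun g => (planeCorrFst g, planeCorrSnd g) = (-1, -1)).card = 2 := by
  decide +kernel

lemma sum_planeCorr (Φ : ℤ → ℤ → ℝ) (s t : ℤ) :
    ∑ g, Φ (s + planeCorrFst g) (t + planeCorrSnd g) =
      Fintype.card (ZMod 2 × ZMod 2 → ZMod 2) * diagStep Φ s t := by
  have h := Finset.sum_fiberwise_of_maps_to (s := univ)
    (fun g _ => planeCorr_mem g) (fun g => Φ (s + planeCorrFst g) (t + planeCorrSnd g))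
  rw [← h]
  have hc : ∀ y : ℤ × ℤ, (∑ g with (planeCorrFst g, planeCorrSnd g) = y,
      Φ (s + planeCorrFst g) (t + planeCorrSnd g)) =
      (univ.filter fun g => (planeCorrFst g, planeCorrSnd g) = y).card *
        Φ (s + y.1) (t + y.2) := fun y => by
    rw [← nsmul_eq_mul]
    refine Finset.sum_eq_card_nsmul fun g hg => ?_
    rw [← (Finset.mem_filter.1 hg).2]
  simp only [hc]
  obtain ⟨h0, h1, h2, h3, h4⟩ := card_planeCorr
  rw [Finset.sum_insert (by decide), Finset.sum_insert (by decide), Finset.sum_insert (by decide),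
    Finset.sum_insert (by decide), Finset.sum_singleton, h0, h1, h2, h3, h4]
  have hcard : Fintype.card (ZMod 2 × ZMod 2 → ZMod 2) = 16 := by
    simp [ZMod.card]
  rw [hcard]
  simp only [diagStep, add_zero, ← sub_eq_add_neg]
  push_cast
  ring

/-- The plane spanned by two vectors of `F_2^n`, parametrised by `F_2^2`. -/
def planeHom {n : ℕ} (u v : Fin n → ZMod 2) : ZMod 2 × ZMod 2 →+ (Fin n → ZMod 2) where
  toFun b := b.1 • u + b.2 • v
  map_zero' := by simp
  map_add' b c := by simp only [Prod.fst_add, Prod.snd_add, add_smul]; abel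

lemma planeHom_injective {n : ℕ} {u v : Fin n → ZMod 2} (hu : u ≠ 0) (hv : v ≠ 0) (huv : u ≠ v) :
    Function.Injective (planeHom u v) := by
  rw [injective_iff_map_eq_zero]
  rintro ⟨a, b⟩ h
  simp only [planeHom, AddMonoidHom.coe_mk, ZeroHom.coe_mk] at h
  have h2 : ∀ x : ZMod 2, x = 0 ∨ x = 1 := by decide
  have hneg : -v = v := by
    funext i
    exact ZMod.neg_eq_self_mod_two _
  rcases h2 a with rfl | rfl <;> rcases h2 b with rfl | rfl
  · rfl
  · simp only [zero_smul, one_smul, zero_add] at h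
    exact absurd h hv
  · simp only [zero_smul, one_smul, add_zero] at h
    exact absurd h hu
  · simp only [one_smul] at h
    rw [add_eq_zero_iff_eq_neg, hneg] at h
    exact absurd h huv

/-- Splitting a finite abelian group into the cosets of the image of an injective homomorphism. -/
lemma exists_equiv_coset {A B : Type*} [AddCommGroup A] [AddCommGroup B] [Finite A]
    (ι : B →+ A) (hι : Function.Injective ι) :
    ∃ (k : ℕ) (e : Fin k × B ≃ A), ∀ i b c, e (i, b + c) = e (i, b) + ι c := by
  obtain ⟨k, ⟨σ⟩⟩ := Finite.exists_equiv_fin (A ⧸ ι.range)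
  let F : Fin k × B → A := fun x => Quotient.out (σ.symm x.1) + ι x.2
  have hmk : ∀ x, ((F x : A) : A ⧸ ι.range) = σ.symm x.1 := fun x => by
    have h1 : ((ι x.2 : A) : A ⧸ ι.range) = 0 := (QuotientAddGroup.eq_zero_iff _).2 ⟨x.2, rfl⟩
    rw [QuotientAddGroup.mk_add, h1, add_zero]
    exact Quotient.out_eq _
  have hF : Function.Bijective F := by
    constructor
    · rintro ⟨i, b⟩ ⟨j, c⟩ h
      have hij : i = j := by
        have := hmk (i, b)
        rw [h, hmk (j, c)] at this
        exact (σ.symm.injective this).symm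
      subst hij
      exact congrArg (Prod.mk i) (hι (add_left_cancel h))
    · intro a
      have : ((Quotient.out (a : A ⧸ ι.range) : A) : A ⧸ ι.range) = a := Quotient.out_eq _
      obtain ⟨b, hb⟩ := QuotientAddGroup.eq.1 this
      refine ⟨(σ (a : A ⧸ ι.range), b), ?_⟩
      simp only [F, Equiv.symm_apply_apply, hb]
      abel
  refine ⟨k, Equiv.ofBijective F hF, fun i b c => ?_⟩
  simp only [Equiv.ofBijective_apply, F, map_add, add_assoc]

lemma avg_ac_ac {n : ℕ} {u v : Fin n → ZMod 2} (hu : u ≠ 0) (hv : v ≠ 0) (huv : u ≠ v)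
    {k : ℕ} (hk : 4 * k = 2 ^ n) (Φ : ℤ → ℤ → ℝ) :
    avg n (fun f => Φ (ac f u) (ac f v)) = diagStep^[k] (fun s t => Φ (4 * s) (4 * t)) 0 0 := by
  obtain ⟨k', e, he⟩ := exists_equiv_coset (planeHom u v) (planeHom_injective hu hv huv)
  have hk' : k' * 4 = 2 ^ n := by
    have := Fintype.card_congr e
    simpa [ZMod.card] using this
  obtain rfl : k' = k := by omega
  let E : (Fin k' → ZMod 2 × ZMod 2 → ZMod 2) ≃ ((Fin n → ZMod 2) → ZMod 2) :=
    (Equiv.curry _ _ _).symm.trans (e.arrowCongr (Equiv.refl _))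
  have hE : ∀ g i b, E g (e (i, b)) = g i b := fun g i b => by simp [E]
  have hfst : ∀ g, ac (E g) u = 4 * (0 + ∑ i, planeCorrFst (g i)) := fun g => by
    rw [zero_add, Finset.mul_sum, ac, ← e.sum_comp, Fintype.sum_prod_type]
    refine Finset.sum_congr rfl fun i _ => ?_
    rw [four_mul_planeCorrFst]
    refine Finset.sum_congr rfl fun b _ => ?_
    have : e (i, b) + u = e (i, b + (1, 0)) := by rw [he]; simp [planeHom]
    rw [this, hE, hE]
  have hsnd : ∀ g, ac (E g) v = 4 * (0 + ∑ i, planeCorrSnd (g i)) := fun g => by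
    rw [zero_add, Finset.mul_sum, ac, ← e.sum_comp, Fintype.sum_prod_type]
    refine Finset.sum_congr rfl fun i _ => ?_
    rw [four_mul_planeCorrSnd]
    refine Finset.sum_congr rfl fun b _ => ?_
    have : e (i, b) + v = e (i, b + (0, 1)) := by rw [he]; simp [planeHom]
    rw [this, hE, hE]
  rw [avg, ← E.sum_comp]
  simp only [hfst, hsnd]
  rw [sum_pi_eq_diagStep_iterate _ _ sum_planeCorr k' fun s t => Φ (4 * s) (4 * t),
    ← Fintype.card_congr E, Fintype.card_fun (α := Fin k'), Fintype.card_fin]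
  push_cast
  rw [mul_div_cancel_left₀]
  positivity

lemma avg_ac {n : ℕ} {u : Fin n → ZMod 2} (hu : u ≠ 0) {k : ℕ} (hk : 4 * k = 2 ^ n)
    (φ : ℤ → ℝ) :
    avg n (fun f => φ (ac f u)) = lazyStep^[k] (fun s => φ (4 * s)) 0 := by
  obtain ⟨v, hv⟩ : ∃ v, v ∉ ({0, u} : Finset (Fin n → ZMod 2)) := by
    by_contra! h
    have h1 : Fintype.card (Fin n → ZMod 2) ≤ 2 :=
      (Finset.card_le_card fun x _ => h x).trans Finset.card_le_two
    simp only [Fintype.card_fun, ZMod.card, Fintype.card_fin] at h1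
    have : k ≠ 0 := by
      rintro rfl
      have := pow_pos (two_pos : (0 : ℕ) < 2) n
      omega
    omega
  simp only [Finset.mem_insert, Finset.mem_singleton, not_or] at hv
  rw [avg_ac_ac hu hv.1 (Ne.symm hv.2) hk fun s _ => φ s,
    diagStep_iterate_fst k fun s => φ (4 * s)]

lemma avg_mono {n : ℕ} {F G : ((Fin n → ZMod 2) → ZMod 2) → ℝ} (h : ∀ f, F f ≤ G f) :
    avg n F ≤ avg n G := by
  unfold avg
  gcongr with f
  exact h f

lemma avg_add {n : ℕ} (F G : ((Fin n → ZMod 2) → ZMod 2) → ℝ) :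
    avg n (fun f => F f + G f) = avg n F + avg n G := by
  simp only [avg, Finset.sum_add_distrib, add_div]

lemma avg_const_mul {n : ℕ} (c : ℝ) (F : ((Fin n → ZMod 2) → ZMod 2) → ℝ) :
    avg n (fun f => c * F f) = c * avg n F := by
  simp only [avg, ← Finset.mul_sum, mul_div_assoc]

lemma avg_const (n : ℕ) (c : ℝ) : avg n (fun _ => c) = c := by
  simp [avg]

lemma avg_sum {n : ℕ} {ι : Type*} (s : Finset ι) (F : ι → ((Fin n → ZMod 2) → ZMod 2) → ℝ) :
    avg n (fun f => ∑ i ∈ s, F i f) = ∑ i ∈ s, avg n (F i) := by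
  simp only [avg, Finset.sum_div]
  rw [Finset.sum_comm]

lemma pr_mono {n : ℕ} {p q : ((Fin n → ZMod 2) → ZMod 2) → Prop} (h : ∀ f, p f → q f) :
    pr n p ≤ pr n q := by
  classical
  unfold pr
  gcongr with f
  exact h f

lemma pr_nonneg (n : ℕ) (p : ((Fin n → ZMod 2) → ZMod 2) → Prop) : 0 ≤ pr n p := by
  unfold pr
  positivity

lemma pr_or_le (n : ℕ) (p q : ((Fin n → ZMod 2) → ZMod 2) → Prop) :
    pr n (fun f => p f ∨ q f) ≤ pr n p + pr n q := by
  classical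
  unfold pr
  rw [← add_div]
  gcongr
  norm_cast
  refine (Finset.card_le_card fun f hf => ?_).trans (Finset.card_union_le _ _)
  simpa using hf

lemma pr_le_avg {n : ℕ} {p : ((Fin n → ZMod 2) → ZMod 2) → Prop}
    {F : ((Fin n → ZMod 2) → ZMod 2) → ℝ} (h0 : ∀ f, 0 ≤ F f) (h1 : ∀ f, p f → 1 ≤ F f) :
    pr n p ≤ avg n F := by
  classical
  unfold pr avg
  gcongr
  rw [Finset.card_filter]
  push_cast
  refine Finset.sum_le_sum fun f _ => ?_
  split_ifs with h
  · exact h1 f h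
  · exact h0 f

lemma card_univ_erase_zero (n : ℕ) :
    (((Finset.univ : Finset (Fin n → ZMod 2)).erase 0).card : ℝ) = 2 ^ n - 1 := by
  rw [Finset.card_erase_of_mem (Finset.mem_univ _), Finset.card_univ, Fintype.card_fun, ZMod.card,
    Fintype.card_fin, Nat.cast_sub Nat.one_le_two_pow]
  push_cast
  ring

lemma avg_exp_ac_le {n : ℕ} {u : Fin n → ZMod 2} (hu : u ≠ 0) {k : ℕ} (hk : 4 * k = 2 ^ n)
    (β : ℝ) : avg n (fun f => Real.exp (β * ac f u)) ≤ Real.exp (2 ^ n * β ^ 2) := by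
  rw [avg_ac hu hk fun m => Real.exp (β * m)]
  have : (fun s : ℤ => Real.exp (β * ((4 * s : ℤ) : ℝ))) =
      fun s : ℤ => Real.exp ((4 * β) * s) := by
    funext s
    push_cast
    congr 1
    ring
  rw [this, lazyStep_iterate_exp]
  simp only [Int.cast_zero, mul_zero, Real.exp_zero, mul_one]
  have hc : 0 ≤ (1 + Real.cosh (4 * β)) / 2 := by linarith [Real.one_le_cosh (4 * β)]
  refine (pow_le_pow_left₀ hc (half_one_add_cosh_le_exp _) k).trans_eq ?_
  rw [← Real.exp_nat_mul]
  congr 1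
  have : (4 : ℝ) * k = 2 ^ n := by exact_mod_cast hk
  rw [← this]
  ring

/-- Chernoff and union bound for the upper tail of the absolute indicator. -/
lemma pr_lt_absInd_le {n k : ℕ} (hk : 4 * k = 2 ^ n) {a β : ℝ} (ha : 0 ≤ a) (hβ : 0 ≤ β) :
    pr n (fun f => a < absInd f) ≤ 2 * 2 ^ n * Real.exp (2 ^ n * β ^ 2 - β * a) := by
  set U := (Finset.univ : Finset (Fin n → ZMod 2)).erase 0 with hU
  have hbound : pr n (fun f => a < absInd f) ≤ avg n (fun f => ∑ u ∈ U,
      Real.exp (-(β * a)) * (Real.exp (β * ac f u) + Real.exp ((-β) * ac f u))) := by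
    refine pr_le_avg (fun f => Finset.sum_nonneg fun u _ => by positivity) fun f hf => ?_
    have hU' : U.Nonempty := by
      by_contra h
      rw [Finset.not_nonempty_iff_eq_empty] at h
      have : absInd f = 0 := by simp [absInd, ← hU, h]
      rw [this] at hf
      simp only [Nat.cast_zero] at hf
      linarith
    obtain ⟨u, hu, hmax⟩ := Finset.exists_mem_eq_sup U hU' fun u => (ac f u).natAbs
    have hval : (absInd f : ℝ) = |(ac f u : ℝ)| := by
      rw [absInd, ← hU, hmax, Nat.cast_natAbs, Int.cast_abs]
    rw [hval] at hf
    refine le_trans ?_ (Finset.single_le_sum (fun u _ => by positivity) hu)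
    have h1 : 1 ≤ Real.exp (-(β * a)) * Real.exp (β * |(ac f u : ℝ)|) := by
      rw [← Real.exp_add, Real.one_le_exp_iff]
      nlinarith
    refine h1.trans (mul_le_mul_of_nonneg_left ?_ (Real.exp_pos _).le)
    rcases abs_choice (ac f u : ℝ) with h | h <;> rw [h]
    · linarith [Real.exp_pos (-β * ac f u)]
    · rw [mul_neg, ← neg_mul]
      linarith [Real.exp_pos (β * ac f u)]
  refine hbound.trans ?_
  rw [avg_sum]
  have hterm : ∀ u ∈ U, avg n (fun f => Real.exp (-(β * a)) *
      (Real.exp (β * ac f u) + Real.exp ((-β) * ac f u))) ≤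
      2 * Real.exp (2 ^ n * β ^ 2 - β * a) := fun u hu => by
    have hu0 : u ≠ 0 := (Finset.mem_erase.1 hu).1
    rw [avg_const_mul, avg_add]
    have h1 := avg_exp_ac_le hu0 hk β
    have h2 := avg_exp_ac_le hu0 hk (-β)
    rw [neg_sq] at h2
    rw [sub_eq_add_neg, Real.exp_add]
    have := mul_le_mul_of_nonneg_left (add_le_add h1 h2) (Real.exp_pos (-(β * a))).le
    linarith
  refine (Finset.sum_le_card_nsmul U _ _ hterm).trans ?_
  rw [nsmul_eq_mul, card_univ_erase_zero]
  have := Real.exp_pos (2 ^ n * β ^ 2 - β * a)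
  nlinarith

/-- The Chebyshev inequality for a sum of functions of the autocorrelations. -/
lemma pr_sum_le_half_le {n : ℕ} {φ : ℤ → ℝ} {p K : ℝ} (hp : 0 < p) (hn : 0 < n)
    (h0 : ∀ m, 0 ≤ φ m) (h1 : ∀ m, φ m ≤ 1) (hK : 1 ≤ K)
    (hmean : ∀ u : Fin n → ZMod 2, u ≠ 0 → avg n (fun f => φ (ac f u)) = p)
    (hpair : ∀ u v : Fin n → ZMod 2, u ≠ 0 → v ≠ 0 → u ≠ v →
      avg n (fun f => φ (ac f u) * φ (ac f v)) ≤ K * p ^ 2) :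
    pr n (fun f => ∑ u ∈ Finset.univ.erase 0, φ (ac f u) ≤ (2 ^ n - 1) * p / 2) ≤
      4 * (1 / ((2 ^ n - 1) * p) + (K - 1)) := by
  set U := (Finset.univ : Finset (Fin n → ZMod 2)).erase 0 with hU
  have hcard : (U.card : ℝ) = 2 ^ n - 1 := card_univ_erase_zero n
  have hN : (0 : ℝ) < 2 ^ n - 1 := by
    have : (1 : ℝ) < 2 ^ n := one_lt_pow₀ (by norm_num) hn.ne'
    linarith
  set μ : ℝ := (2 ^ n - 1) * p with hμ
  have hμ0 : 0 < μ := mul_pos hN hp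
  have hne : ∀ u ∈ U, u ≠ 0 := fun u hu => (Finset.mem_erase.1 hu).1
  have hZ : avg n (fun f => ∑ u ∈ U, φ (ac f u)) = μ := by
    rw [avg_sum, Finset.sum_congr rfl fun u hu => hmean u (hne u hu), Finset.sum_const,
      nsmul_eq_mul, hcard]
  have hZ2 : avg n (fun f => (∑ u ∈ U, φ (ac f u)) ^ 2) ≤ μ + K * μ ^ 2 := by
    simp only [sq (∑ u ∈ U, _), Finset.sum_mul_sum]
    rw [avg_sum]
    have hrow : ∀ u ∈ U, avg n (fun f => ∑ v ∈ U, φ (ac f u) * φ (ac f v)) ≤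
        p + (2 ^ n - 1) * (K * p ^ 2) := fun u hu => by
      rw [avg_sum, ← Finset.add_sum_erase U _ hu]
      refine add_le_add ?_ ?_
      · rw [← hmean u (hne u hu)]
        exact avg_mono fun f => mul_le_of_le_one_right (h0 _) (h1 _)
      · refine (Finset.sum_le_card_nsmul _ _ (K * p ^ 2) fun v hv => ?_).trans ?_
        · exact hpair u v (hne u hu) (hne v (Finset.mem_of_mem_erase hv))
            (Finset.ne_of_mem_erase hv).symm
        · rw [nsmul_eq_mul, ← hcard]
          gcongr
          exact Finset.erase_subset _ _
    refine (Finset.sum_le_card_nsmul U _ _ hrow).trans_eq ?_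
    rw [nsmul_eq_mul, hcard, hμ]
    ring
  have hcheb : pr n (fun f => ∑ u ∈ U, φ (ac f u) ≤ μ / 2) ≤
      avg n (fun f => (4 / μ ^ 2) * (((∑ u ∈ U, φ (ac f u)) ^ 2 +
        (-(2 * μ)) * ∑ u ∈ U, φ (ac f u)) + μ ^ 2)) := by
    refine pr_le_avg (fun f => ?_) fun f hf => ?_
    · have : (∑ u ∈ U, φ (ac f u)) ^ 2 + (-(2 * μ)) * (∑ u ∈ U, φ (ac f u)) + μ ^ 2 =
          ((∑ u ∈ U, φ (ac f u)) - μ) ^ 2 := by ring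
      rw [this]
      positivity
    · rw [div_mul_eq_mul_div, one_le_div (by positivity)]
      nlinarith
  refine hcheb.trans ?_
  rw [avg_const_mul, avg_add, avg_add, avg_const_mul, avg_const, hZ]
  calc 4 / μ ^ 2 * (avg n (fun f => (∑ u ∈ U, φ (ac f u)) ^ 2) + -(2 * μ) * μ + μ ^ 2)
      ≤ 4 / μ ^ 2 * (μ + K * μ ^ 2 + -(2 * μ) * μ + μ ^ 2) := by gcongr
    _ = 4 * (1 / μ + (K - 1)) := by
      field_simp
      ring

/-- Second moment bound for the lower tail of the absolute indicator. -/
lemma pr_absInd_lt_le {n k : ℕ} (hk : 4 * k = 2 ^ n) (hn : 0 < n) {a θ l q : ℝ} (hθ : 0 ≤ θ)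
    (hl : 0 ≤ l) (hsinh : Real.sinh l ^ 2 ≤ 1)
    (hq : q = Real.exp (-(k * θ ^ 2 / 4) - k * θ ^ 4 / 16 - l * √k))
    (ha : 4 * Real.exp (-(l * (k * Real.tanh (θ / 2) - a / 4))) ≤ q) :
    pr n (fun f => absInd f < a) ≤
      4 * (1 / ((2 ^ n - 1) * q) + ((1 + Real.sinh l ^ 4) ^ k - 1)) := by
  have hk0 : 0 < k := by
    have := pow_pos (two_pos : (0 : ℕ) < 2) n
    omega
  set c : ℝ := k * Real.tanh (θ / 2) with hc
  set ψ : ℤ → ℝ := fun s => 1 / Real.cosh (l * (s - c)) with hψ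
  set φ : ℤ → ℝ := fun m => 1 / Real.cosh (l * (m / 4 - c)) with hφ
  have hφψ : ∀ s : ℤ, φ (4 * s) = ψ s := fun s => by
    simp only [hφ, hψ]
    push_cast
    rw [mul_div_cancel_left₀ _ (by norm_num)]
  set p := lazyStep^[k] ψ 0 with hp
  have hqp : q ≤ p := by
    rw [hq]
    exact le_lazyStep_iterate_sech k hk0 hθ hl
  have hq0 : 0 < q := by rw [hq]; exact Real.exp_pos _
  have hp0 : 0 < p := hq0.trans_le hqp
  have hN : (0 : ℝ) < 2 ^ n - 1 := by
    have : (1 : ℝ) < 2 ^ n := one_lt_pow₀ (by norm_num) hn.ne'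
    linarith
  have hψ0 : ∀ s, 0 ≤ ψ s := fun s => one_div_nonneg.2 (Real.cosh_pos _).le
  have hmain := pr_sum_le_half_le (n := n) (φ := φ) (K := (1 + Real.sinh l ^ 4) ^ k) hp0 hn
    (fun m => one_div_nonneg.2 (Real.cosh_pos _).le)
    (fun m => (div_le_one (Real.cosh_pos _)).2 (Real.one_le_cosh _))
    (one_le_pow₀ (by linarith [pow_nonneg (sq_nonneg (Real.sinh l)) 2]))
    (fun u hu => by rw [avg_ac hu hk φ]; simp only [hφψ]; rfl)
    (fun u v hu hv huv => by
      rw [avg_ac_ac hu hv huv hk fun s t => φ s * φ t]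
      simp only [hφψ]
      refine (diagStep_iterate_mul_le k (η := Real.sinh l ^ 2 / 2) (by linarith) hψ0
        (abs_lazyStep_sech_sub_le l c) 0 0).trans_eq ?_
      rw [sq p]
      congr 2
      ring)
  refine (pr_mono fun f hf => ?_).trans (hmain.trans ?_)
  · have hterm : ∀ u ∈ (Finset.univ : Finset (Fin n → ZMod 2)).erase 0, φ (ac f u) ≤ p / 2 :=
      fun u hu => by
        have h1 : (ac f u).natAbs ≤ absInd f :=
          Finset.le_sup (f := fun u => (ac f u).natAbs) hu
        have h2 : (ac f u : ℝ) ≤ absInd f := by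
          have : ((ac f u).natAbs : ℝ) ≤ absInd f := by exact_mod_cast h1
          rw [Nat.cast_natAbs, Int.cast_abs] at this
          exact (le_abs_self _).trans this
        have h3 : φ (ac f u) ≤ 2 * Real.exp (l * (ac f u / 4 - c)) := by
          simp only [hφ]
          rw [div_le_iff₀ (Real.cosh_pos _), Real.cosh_eq, Real.exp_neg]
          have := Real.exp_pos (l * (ac f u / 4 - c))
          field_simp
          nlinarith
        have h4 : Real.exp (l * (ac f u / 4 - c)) ≤ Real.exp (-(l * (c - a / 4))) := by
          refine Real.exp_le_exp.2 ?_
          have : l * ((ac f u : ℝ) / 4) ≤ l * (a / 4) := by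
            refine mul_le_mul_of_nonneg_left ?_ hl
            linarith
          linarith
        linarith
    refine (Finset.sum_le_card_nsmul _ _ _ hterm).trans_eq ?_
    rw [nsmul_eq_mul, card_univ_erase_zero]
    ring
  · gcongr

lemma tendsto_log_two_pow_atTop : Tendsto (fun n : ℕ => Real.log (2 ^ n)) atTop atTop := by
  simp only [Real.log_pow]
  exact tendsto_natCast_atTop_atTop.atTop_mul_const (Real.log_pos one_lt_two)

lemma tendsto_log_two_pow_pow_div (j : ℕ) :
    Tendsto (fun n : ℕ => Real.log (2 ^ n) ^ j / 2 ^ n) atTop (nhds 0) := by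
  have := (tendsto_pow_const_div_const_pow_of_one_lt j (one_lt_two : (1 : ℝ) < 2)).const_mul
    (Real.log 2 ^ j)
  rw [mul_zero] at this
  refine this.congr fun n => ?_
  rw [Real.log_pow, mul_pow]
  ring

lemma four_mul_two_pow_sub_two {n : ℕ} (hn : 2 ≤ n) : 4 * 2 ^ (n - 2) = 2 ^ n := by
  rw [← pow_mul_pow_sub 2 hn]
  norm_num

lemma tendsto_pr_lt_absInd {ε : ℝ} (hε : 0 < ε) :
    Tendsto (fun n => pr n fun f =>
      (1 + ε) * (2 * Real.sqrt (2 ^ n * Real.log (2 ^ n))) < absInd f) atTop (nhds 0) := by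
  have hlim : Tendsto (fun n : ℕ => 2 * Real.exp (-(((1 + ε) ^ 2 - 1) * Real.log (2 ^ n))))
      atTop (nhds 0) := by
    have h1 : 0 < (1 + ε) ^ 2 - 1 := by nlinarith
    have := (Real.tendsto_exp_neg_atTop_nhds_zero.comp
      (tendsto_log_two_pow_atTop.const_mul_atTop h1)).const_mul 2
    simpa using this
  refine squeeze_zero' (Eventually.of_forall fun n => pr_nonneg n _) ?_ hlim
  filter_upwards [eventually_ge_atTop 2] with n hn
  have hN : (0 : ℝ) < 2 ^ n := by positivity
  have hL : 0 ≤ Real.log (2 ^ n) := Real.log_nonneg (one_le_pow₀ one_le_two)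
  have hexp : Real.exp (Real.log (2 ^ n)) = 2 ^ n := Real.exp_log hN
  rw [Real.sqrt_mul hN.le]
  set N : ℝ := 2 ^ n
  set L := Real.log N
  set x := √N with hx
  set y := √L with hy
  have hx0 : 0 < x := Real.sqrt_pos.2 hN
  have hxx : x * x = N := Real.mul_self_sqrt hN.le
  have hyy : y * y = L := Real.mul_self_sqrt hL
  refine (pr_lt_absInd_le (four_mul_two_pow_sub_two hn) (β := (1 + ε) * y / x)
    (by positivity) (by positivity)).trans_eq ?_
  change 2 * N * _ = _
  rw [← hexp, mul_assoc, ← Real.exp_add]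
  congr 2
  change L + (N * _ - _) = _
  rw [← hxx, ← hyy]
  field_simp
  ring

lemma sinh_le_two_mul {l : ℝ} (hl : 0 ≤ l) (hl1 : l ≤ 1 / 2) : Real.sinh l ≤ 2 * l := by
  have h5 : Real.cosh l ≤ 2 := by
    have h7 := Real.cosh_le_exp_half_sq l
    have h8 : 1 - l ^ 2 / 2 ≤ Real.exp (-(l ^ 2 / 2)) := by
      linarith [Real.add_one_le_exp (-(l ^ 2 / 2))]
    have h9 : Real.exp (l ^ 2 / 2) * Real.exp (-(l ^ 2 / 2)) = 1 := by
      rw [← Real.exp_add, add_neg_cancel, Real.exp_zero]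
    have h10 : (1 : ℝ) / 2 ≤ 1 - l ^ 2 / 2 := by nlinarith
    nlinarith [Real.exp_pos (l ^ 2 / 2)]
  have := sinh_le_mul_cosh hl
  nlinarith

lemma exp_neg_le_tilted_mass {ε d N L x y r : ℝ} (hd : d = 1 - ε / 2) (hd0 : 0 < d)
    (hd1 : d ≤ 1) (hL : 3 ≤ L) (hyy : y * y = L) (hy0 : 0 < y) (hrL : N * r ^ 2 = L)
    (hrx : r * x = y) (hr4 : N * r ^ 4 = L ^ 2 / N) (h0 : 0 ≤ L ^ 2 / N) (h2 : L ^ 2 / N ≤ 1 / 4)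
    (hy_le : 8 / ε + 1 ≤ y * (ε / 2 * d)) :
    Real.exp (-(d * L)) ≤ Real.exp (-(N / 4 * (4 * d * r) ^ 2 / 4) -
      N / 4 * (4 * d * r) ^ 4 / 16 - 16 / ε * r * (x / 2)) := by
  rw [Real.exp_le_exp]
  have e1 : N / 4 * (4 * d * r) ^ 2 / 4 = d ^ 2 * L := by rw [← hrL]; ring
  have e2 : N / 4 * (4 * d * r) ^ 4 / 16 = 4 * d ^ 4 * (L ^ 2 / N) := by rw [← hr4]; ring
  have e3 : 16 / ε * r * (x / 2) = 8 / ε * y := by rw [← hrx]; ring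
  rw [e1, e2, e3]
  have h5 : 4 * d ^ 4 * (L ^ 2 / N) ≤ 1 := by
    have : d ^ 4 ≤ 1 := pow_le_one₀ hd0.le hd1
    nlinarith
  have h6 : (8 / ε + 1) * y ≤ ε / 2 * d * L := by
    rw [← hyy]
    nlinarith
  have h7 : 1 ≤ y := by
    by_contra! h
    nlinarith
  have h8 : d * L - d ^ 2 * L = ε / 2 * d * L := by
    rw [show ε / 2 = 1 - d by rw [hd]; ring]
    ring
  nlinarith

lemma two_mul_le_tilted_gap {ε d N L x y r : ℝ} (hε : 0 < ε) (hd : d = 1 - ε / 2) (hd0 : 0 < d)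
    (hd1 : d ≤ 1) (hN : 0 < N) (hL : 3 ≤ L) (hx0 : 0 < x) (hy0 : 0 < y) (hr0 : 0 < r)
    (hrL : N * r ^ 2 = L) (hrxy : N * r = x * y) (hr_le : r ≤ ε / 32) :
    2 * L ≤ 16 / ε * r *
      (N / 4 * Real.tanh (4 * d * r / 2) - (1 - ε) * (2 * (x * y)) / 4) := by
  have h6 : 4 * d * r / 2 - (4 * d * r / 2) ^ 2 ≤ Real.tanh (4 * d * r / 2) :=
    sub_sq_le_tanh (by positivity)
  have h7 : N / 4 * (4 * d * r / 2 - (4 * d * r / 2) ^ 2) ≤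
      N / 4 * Real.tanh (4 * d * r / 2) := by gcongr
  have h8 : N / 4 * (4 * d * r / 2 - (4 * d * r / 2) ^ 2) = d * (x * y) / 2 - d ^ 2 * L := by
    rw [← hrxy, ← hrL]
    ring
  have h9 : d ^ 2 * L ≤ ε / 8 * (x * y) := by
    have h10 : L = r * (x * y) := by rw [← hrL, ← hrxy]; ring
    have h11 : d ^ 2 ≤ 1 := pow_le_one₀ hd0.le hd1
    calc d ^ 2 * L ≤ 1 * L := by gcongr
      _ = r * (x * y) := by rw [one_mul, h10]
      _ ≤ ε / 8 * (x * y) := by gcongr; linarith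
  have h10 : ε / 8 * (x * y) ≤
      N / 4 * Real.tanh (4 * d * r / 2) - (1 - ε) * (2 * (x * y)) / 4 := by
    have : d * (x * y) / 2 = (x * y) / 2 - ε / 4 * (x * y) := by rw [hd]; ring
    linarith
  calc 2 * L = 16 / ε * r * (ε / 8 * (x * y)) := by
        rw [← hrL, ← hrxy]
        field_simp
        norm_num
    _ ≤ _ := by gcongr

set_option maxHeartbeats 1000000 in
lemma tendsto_pr_absInd_lt {ε : ℝ} (hε : 0 < ε) (hε1 : ε < 1) :
    Tendsto (fun n => pr n fun f =>
      absInd f < (1 - ε) * (2 * Real.sqrt (2 ^ n * Real.log (2 ^ n)))) atTop (nhds 0) := by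
  set C : ℝ := 4 * (16 / ε) ^ 4 with hC
  have hlim : Tendsto (fun n : ℕ => 4 * (2 * Real.exp (-(ε / 2 * Real.log (2 ^ n))) +
      (Real.exp (C * (Real.log (2 ^ n) ^ 2 / 2 ^ n)) - 1))) atTop (nhds 0) := by
    have h1 := (Real.tendsto_exp_neg_atTop_nhds_zero.comp
      (tendsto_log_two_pow_atTop.const_mul_atTop (half_pos hε))).const_mul 2
    have h2 := ((Real.continuous_exp.tendsto _).comp
      ((tendsto_log_two_pow_pow_div 2).const_mul C)).sub_const 1
    have := (h1.add h2).const_mul 4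
    simpa using this
  refine squeeze_zero' (Eventually.of_forall fun n => pr_nonneg n _) ?_ hlim
  have hδ : 0 < ε / 2 * (1 - ε / 2) := mul_pos (by linarith) (by linarith)
  have hev1 : ∀ᶠ n : ℕ in atTop, Real.log (2 ^ n) / 2 ^ n ≤ (ε / 32) ^ 2 := by
    have := tendsto_log_two_pow_pow_div 1
    simp only [pow_one] at this
    exact this.eventually_le_const (by positivity)
  have hev2 : ∀ᶠ n : ℕ in atTop, Real.log (2 ^ n) ^ 2 / 2 ^ n ≤ 1 / 4 :=
    (tendsto_log_two_pow_pow_div 2).eventually_le_const (by norm_num)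
  filter_upwards [eventually_ge_atTop 2, hev1, hev2, tendsto_log_two_pow_atTop.eventually_ge_atTop 3,
    tendsto_log_two_pow_atTop.eventually_ge_atTop
      (((8 / ε + 1) / (ε / 2 * (1 - ε / 2))) ^ 2)] with n hn h1 h2 h3 h4
  have hk := four_mul_two_pow_sub_two hn
  have hkR : ((2 ^ (n - 2) : ℕ) : ℝ) = 2 ^ n / 4 := by
    rw [eq_div_iff (by norm_num), mul_comm]
    exact_mod_cast hk
  have hN : (0 : ℝ) < 2 ^ n := by positivity
  have hN2 : (2 : ℝ) ≤ 2 ^ n := by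
    simpa using pow_le_pow_right₀ (one_le_two : (1 : ℝ) ≤ 2) (by omega : 1 ≤ n)
  have hexp : Real.exp (Real.log (2 ^ n)) = 2 ^ n := Real.exp_log hN
  rw [Real.sqrt_mul hN.le]
  have hmain := fun a θ l q => pr_absInd_lt_le hk (by omega : 0 < n) (a := a) (θ := θ) (l := l)
    (q := q)
  rw [hkR] at hmain
  set k := 2 ^ (n - 2)
  set N : ℝ := 2 ^ n
  set L := Real.log N
  set x := √N with hx
  set y := √L with hy
  clear_value k x y L N
  have hx0 : 0 < x := by rw [hx]; exact Real.sqrt_pos.2 hN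
  have hxx : x * x = N := by rw [hx, Real.mul_self_sqrt hN.le]
  have hyy : y * y = L := by rw [hy, Real.mul_self_sqrt (by linarith)]
  have hy0 : 0 < y := by rw [hy]; exact Real.sqrt_pos.2 (by linarith)
  have hkx : √(N / 4) = x / 2 := by
    rw [Real.sqrt_eq_iff_mul_self_eq (by positivity) (by positivity), ← hxx]
    ring
  rw [hkx] at hmain
  set r := y / x with hr
  have hr0 : 0 < r := div_pos hy0 hx0
  have hrL : N * r ^ 2 = L := by
    rw [hr, ← hxx, ← hyy]
    field_simp
  have hrxy : N * r = x * y := by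
    rw [hr, ← hxx]
    field_simp
  have hrx : r * x = y := by
    rw [hr]
    field_simp
  have hr4 : N * r ^ 4 = L ^ 2 / N := by
    rw [eq_div_iff hN.ne', ← hrL]
    ring
  have hr_le : r ≤ ε / 32 := by
    refine le_of_sq_le_sq ?_ (by positivity)
    refine le_trans (le_of_eq ?_) h1
    rw [eq_div_iff hN.ne', ← hrL]
    ring
  have hy_le : (8 / ε + 1) ≤ y * (ε / 2 * (1 - ε / 2)) := by
    rw [← div_le_iff₀ hδ]
    rw [hy]
    exact Real.le_sqrt_of_sq_le h4
  set d := 1 - ε / 2 with hd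
  have hd0 : 0 < d := by rw [hd]; linarith
  have hd1 : d ≤ 1 := by rw [hd]; linarith
  set l := 16 / ε * r with hl
  have hl0 : 0 < l := by positivity
  have hl1 : l ≤ 1 / 2 := by
    calc l ≤ 16 / ε * (ε / 32) := by rw [hl]; gcongr
      _ = 1 / 2 := by field_simp; norm_num
  have hsinh0 : 0 ≤ Real.sinh l := Real.sinh_nonneg_iff.2 hl0.le
  have hsinh : Real.sinh l ≤ 2 * l := sinh_le_two_mul hl0.le hl1
  set q := Real.exp (-(N / 4 * (4 * d * r) ^ 2 / 4) - N / 4 * (4 * d * r) ^ 4 / 16 - l * (x / 2))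
    with hq
  have hql : Real.exp (-(d * L)) ≤ q :=
    exp_neg_le_tilted_mass hd hd0 hd1 h3 hyy hy0 hrL hrx hr4 (by positivity) h2 hy_le
  have hq0 : 0 < q := Real.exp_pos _
  have hcond : 4 * Real.exp (-(l * (N / 4 * Real.tanh (4 * d * r / 2) -
      (1 - ε) * (2 * (x * y)) / 4))) ≤ q := by
    refine le_trans ?_ hql
    have h5 : 2 * L ≤ l * (N / 4 * Real.tanh (4 * d * r / 2) - (1 - ε) * (2 * (x * y)) / 4) :=
      two_mul_le_tilted_gap hε hd hd0 hd1 hN h3 hx0 hy0 hr0 hrL hrxy hr_le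
    have h6 : Real.exp (-(l * (N / 4 * Real.tanh (4 * d * r / 2) -
        (1 - ε) * (2 * (x * y)) / 4))) ≤ Real.exp (-L) * Real.exp (-(d * L)) := by
      rw [← Real.exp_add, Real.exp_le_exp]
      nlinarith
    have h7 : 4 * Real.exp (-L) ≤ 1 := by
      rw [Real.exp_neg, ← div_eq_mul_inv, div_le_one (Real.exp_pos _)]
      linarith [Real.add_one_le_exp L]
    nlinarith [Real.exp_pos (-(d * L))]
  refine (hmain _ (4 * d * r) l q (by positivity) hl0.le (by nlinarith) hq hcond).trans ?_
  gcongr ?_ * (?_ + (?_ - 1))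
  · calc 1 / ((N - 1) * q) ≤ 1 / (N / 2 * Real.exp (-(d * L))) := by
          gcongr <;> linarith
      _ = 2 * Real.exp (-(ε / 2 * L)) := by
          have : Real.exp (-(ε / 2 * L)) = Real.exp (d * L) * N⁻¹ := by
            rw [← hexp, ← Real.exp_neg, ← Real.exp_add, hd]
            ring_nf
          rw [this, Real.exp_neg]
          field_simp
  · calc (1 + Real.sinh l ^ 4) ^ k ≤ Real.exp (Real.sinh l ^ 4) ^ k := by
          gcongr
          linarith [Real.add_one_le_exp (Real.sinh l ^ 4)]
      _ = Real.exp (k * Real.sinh l ^ 4) := by rw [← Real.exp_nat_mul]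
      _ ≤ Real.exp (C * (L ^ 2 / N)) := by
          rw [Real.exp_le_exp, hkR, hC, ← hr4]
          calc N / 4 * Real.sinh l ^ 4 ≤ N / 4 * (2 * l) ^ 4 := by gcongr
            _ = 4 * (16 / ε) ^ 4 * (N * r ^ 4) := by rw [hl]; ring

theorem stmt15 (ε : ℝ) (hε : 0 < ε) :
    Tendsto
      (fun n => pr n fun f =>
        ε < |(absInd f : ℝ) / (2 * Real.sqrt (2 ^ n * Real.log (2 ^ n))) - 1|)
      atTop (nhds 0) := by
  set δ := min ε (1 / 2) with hδ
  have hδ0 : 0 < δ := lt_min hε (by norm_num)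
  have hδ1 : δ < 1 := (min_le_right _ _).trans_lt (by norm_num)
  have hlim := (tendsto_pr_lt_absInd hδ0).add (tendsto_pr_absInd_lt hδ0 hδ1)
  rw [add_zero] at hlim
  refine squeeze_zero' (Eventually.of_forall fun n => pr_nonneg n _) ?_ hlim
  filter_upwards [eventually_ge_atTop 1] with n hn
  refine (pr_mono fun f hf => ?_).trans (pr_or_le n _ _)
  have hpos : 0 < 2 * Real.sqrt (2 ^ n * Real.log (2 ^ n)) := by
    have : 0 < Real.log (2 ^ n) := Real.log_pos (one_lt_pow₀ one_lt_two (by omega))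
    positivity
  have hf' := (min_le_left ε (1 / 2)).trans_lt hf
  rw [← hδ] at hf'
  rcases lt_abs.1 hf' with h | h
  · left
    rw [← lt_div_iff₀ hpos]
    linarith
  · right
    rw [← div_lt_iff₀ hpos]
    linarith
end
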